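/- Let n ≥ 2 and let f be a nonconstant real polynomial on ℝ^n such that {x' ∈ ℝ^n : f(x') < 0} is bounded. Then for every δ > 0 there exists a global solution u to the thin obstacle problem (with zero obstacle) in ℝ^{n+1} with polynomial growth such that {x' : f(x') ≤ −δ} × {0} ⊆ Λ(u) ⊆ {x' : f(x') ≤ 0} × {0}. -/

import Mathlib

open MeasureTheory Metric Set Filter

noncomputable section

/-- The point `(x', t)` of `ℝ^{n+1}`, where `x' ∈ ℝ^n`. -/
def thinEmbed (n : ℕ) (x' : EuclideanSpace ℝ (Fin n)) (t : ℝ) :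
    EuclideanSpace ℝ (Fin (n + 1)) :=
  (EuclideanSpace.equiv (Fin (n + 1)) ℝ).symm (Fin.snoc (fun i => x' i) t)

/-- Projection of a point of `ℝ^{n+1}` to its first `n` coordinates. -/
def thinProj (n : ℕ) (x : EuclideanSpace ℝ (Fin (n + 1))) : EuclideanSpace ℝ (Fin n) :=
  (EuclideanSpace.equiv (Fin n) ℝ).symm (fun i => x i.castSucc)

/-- The Laplacian of `f : ℝ^d → ℝ`: the sum of pure second partial derivatives. -/
def lapl (d : ℕ) (f : EuclideanSpace ℝ (Fin d) → ℝ) (x : EuclideanSpace ℝ (Fin d)) : ℝ :=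
  ∑ i : Fin d,
    fderiv ℝ (fun y => fderiv ℝ f y (EuclideanSpace.single i 1)) x (EuclideanSpace.single i 1)

/-- `f` is harmonic on a set: twice continuously differentiable with vanishing Laplacian. -/
def IsHarmonicOnSet (d : ℕ) (f : EuclideanSpace ℝ (Fin d) → ℝ)
    (s : Set (EuclideanSpace ℝ (Fin d))) : Prop :=
  ContDiffOn ℝ 2 f s ∧ ∀ x ∈ s, lapl d f x = 0

/-- Super-mean-value property w.r.t. averages over balls
(encodes `Δf ≤ 0` for continuous `f`). -/
def SuperMeanVal (d : ℕ) (f : EuclideanSpace ℝ (Fin d) → ℝ) : Prop :=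
  ∀ (x : EuclideanSpace ℝ (Fin d)) (r : ℝ), 0 < r → (⨍ y in Metric.ball x r, f y) ≤ f x

/-- The contact set `Λ_φ(u) = {(x',0) : u(x',0) = φ(x')}`. -/
def contactSet (n : ℕ) (φ : EuclideanSpace ℝ (Fin n) → ℝ)
    (u : EuclideanSpace ℝ (Fin (n + 1)) → ℝ) : Set (EuclideanSpace ℝ (Fin (n + 1))) :=
  {x | x (Fin.last n) = 0 ∧ u x = φ (thinProj n x)}

/-- Global solution to the thin obstacle problem in `ℝ^{n+1}` with thin obstacle `φ`:
continuous, even in the last variable, above the obstacle on the thin space,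
harmonic outside the contact set, and superharmonic (mean value inequality). -/
def IsGlobalSolution (n : ℕ) (φ : EuclideanSpace ℝ (Fin n) → ℝ)
    (u : EuclideanSpace ℝ (Fin (n + 1)) → ℝ) : Prop :=
  Continuous u ∧
  (∀ x' t, u (thinEmbed n x' t) = u (thinEmbed n x' (-t))) ∧
  (∀ x', φ x' ≤ u (thinEmbed n x' 0)) ∧
  IsHarmonicOnSet (n + 1) u (contactSet n φ u)ᶜ ∧
  SuperMeanVal (n + 1) u

/-- Evaluation of a real polynomial at a point of `ℝ^d`. -/
def pev {d : ℕ} (q : MvPolynomial (Fin d) ℝ) (x : EuclideanSpace ℝ (Fin d)) : ℝ :=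
  MvPolynomial.eval (fun i => x i) q

/-- Polynomial growth (of some order). -/
def HasPolyGrowth (d : ℕ) (u : EuclideanSpace ℝ (Fin d) → ℝ) : Prop :=
  ∃ (m : ℕ) (C : ℝ), ∀ x, |u x| ≤ C * (1 + ‖x‖ ^ m)

/-- Polynomial growth of order exactly `m` (and `m` is the smallest such order). -/
def PolyGrowthOrder (d : ℕ) (u : EuclideanSpace ℝ (Fin d) → ℝ) (m : ℕ) : Prop :=
  (∃ C : ℝ, ∀ x, |u x| ≤ C * (1 + ‖x‖ ^ m)) ∧
  ∀ m' : ℕ, (∃ C : ℝ, ∀ x, |u x| ≤ C * (1 + ‖x‖ ^ m')) → m ≤ m'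

/-- The class `𝒫ᵒ_{n+1}`: polynomials `q` even in the last variable such that
`x_{n+1} q(x)` is harmonic and `closure {q(·,0) < 0}` is compact. -/
def MemPo (n : ℕ) (q : MvPolynomial (Fin (n + 1)) ℝ) : Prop :=
  (∀ x' t, pev q (thinEmbed n x' t) = pev q (thinEmbed n x' (-t))) ∧
  IsHarmonicOnSet (n + 1) (fun x => x (Fin.last n) * pev q x) Set.univ ∧
  IsCompact (closure {x' : EuclideanSpace ℝ (Fin n) | pev q (thinEmbed n x' 0) < 0})

/-- The class `𝒫ᵉ_{n+1}`: harmonic polynomials `p` even in the last variable such that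
`closure {p(·,0) < 0}` is compact. -/
def MemPe (n : ℕ) (p : MvPolynomial (Fin (n + 1)) ℝ) : Prop :=
  (∀ x' t, pev p (thinEmbed n x' t) = pev p (thinEmbed n x' (-t))) ∧
  IsHarmonicOnSet (n + 1) (pev p) Set.univ ∧
  IsCompact (closure {x' : EuclideanSpace ℝ (Fin n) | pev p (thinEmbed n x' 0) < 0})

/-- `f(x) → 0` as `|x| → ∞`. -/
def VanishAtInfty (d : ℕ) (f : EuclideanSpace ℝ (Fin d) → ℝ) : Prop :=
  ∀ ε > 0, ∃ R : ℝ, ∀ x, R ≤ ‖x‖ → |f x| < ε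

/-- The embedding of a subset of `ℝ^n` into the thin space of `ℝ^{n+1}`. -/
def thinSet (n : ℕ) (S : Set (EuclideanSpace ℝ (Fin n))) :
    Set (EuclideanSpace ℝ (Fin (n + 1))) :=
  (fun x' => thinEmbed n x' 0) '' S

/-- The free boundary `Γ(u)`: the boundary in `ℝ^n` of the positivity set, embedded. -/
def freeBoundary (n : ℕ) (u : EuclideanSpace ℝ (Fin (n + 1)) → ℝ) :
    Set (EuclideanSpace ℝ (Fin (n + 1))) :=
  thinSet n (frontier {x' : EuclideanSpace ℝ (Fin n) | 0 < u (thinEmbed n x' 0)})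

/-- Negating the `i`-th coordinate of a point of `ℝ^d`. -/
def negCoordAt (d : ℕ) (i : Fin d) (x : EuclideanSpace ℝ (Fin d)) :
    EuclideanSpace ℝ (Fin d) :=
  (EuclideanSpace.equiv (Fin d) ℝ).symm (Function.update (fun j => x j) i (-(x i)))

/-- The constant `ρ̄(k, n)`, where `κ = k/(n-1)`. -/
def rhoBar (k n : ℕ) : ℝ :=
  ((k : ℝ) / ((n : ℝ) - 1)) ^ (-(1 : ℝ) / (((n : ℝ) - 1) * ((k : ℝ) / ((n : ℝ) - 1) + 1))) *
    (((k : ℝ) / ((n : ℝ) - 1)) ^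
        (-((k : ℝ) / ((n : ℝ) - 1)) / ((k : ℝ) / ((n : ℝ) - 1) + 1)) +
      ((k : ℝ) / ((n : ℝ) - 1)) ^ ((1 : ℝ) / ((k : ℝ) / ((n : ℝ) - 1) + 1))) ^
      (-(1 : ℝ) / (((n : ℝ) - 1) * ((k : ℝ) / ((n : ℝ) - 1))))

/-- The barrier function `g_{A,t}(r) = A r^{1-n} + t - 1 + r^k`. -/
def gfun (n k : ℕ) (A t r : ℝ) : ℝ :=
  A * r ^ ((1 : ℝ) - (n : ℝ)) + t - 1 + r ^ k

open scoped Topology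

/-- Radial cutoff kernel of steepness `c`, positive exactly on the open unit ball. -/
def radialKer (d : ℕ) (c : ℝ) (y : EuclideanSpace ℝ (Fin d)) : ℝ :=
  Real.smoothTransition (c * (1 - ‖y‖ ^ 2))

/-- The profile of the radial potential of the kernel. -/
def potProfile (c τ : ℝ) : ℝ :=
  (1 / 2) * ∫ σ in τ..1, Real.smoothTransition (c * (1 - σ))

/-- Radial potential whose gradient is `-y` times the kernel. -/
def radialPot (d : ℕ) (c : ℝ) (y : EuclideanSpace ℝ (Fin d)) : ℝ :=
  potProfile c (‖y‖ ^ 2)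

/-- The kernel average of `g` at scale `s` (not normalised). -/
def kerAvg (d : ℕ) (c s : ℝ) (g : EuclideanSpace ℝ (Fin d) → ℝ)
    (x : EuclideanSpace ℝ (Fin d)) : ℝ :=
  ∫ y, g (x + s • y) * radialKer d c y

/-- Total mass of the kernel. -/
def kerMass (d : ℕ) (c : ℝ) : ℝ := ∫ y, radialKer d c y

/-- Total mass of the radial potential. -/
def potMass (d : ℕ) (c : ℝ) : ℝ := ∫ y, radialPot d c y

section Kernel

variable {d : ℕ} {c : ℝ}

lemma radialKer_nonneg (y : EuclideanSpace ℝ (Fin d)) : 0 ≤ radialKer d c y :=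
  Real.smoothTransition.nonneg _

lemma radialKer_le_one (y : EuclideanSpace ℝ (Fin d)) : radialKer d c y ≤ 1 :=
  Real.smoothTransition.le_one _

lemma radialKer_eq_zero (hc : 0 < c) {y : EuclideanSpace ℝ (Fin d)} (hy : 1 ≤ ‖y‖) :
    radialKer d c y = 0 := by
  apply Real.smoothTransition.zero_of_nonpos
  have : 1 ≤ ‖y‖ ^ 2 := one_le_pow₀ hy
  nlinarith

lemma radialKer_pos (hc : 0 < c) {y : EuclideanSpace ℝ (Fin d)} (hy : ‖y‖ < 1) :
    0 < radialKer d c y := by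
  apply Real.smoothTransition.pos_of_pos
  have : ‖y‖ ^ 2 < 1 := by
    have := norm_nonneg y
    nlinarith
  exact mul_pos hc (by linarith)

lemma contDiff_radialKer {k : ℕ∞} : ContDiff ℝ k (radialKer d c) := by
  unfold radialKer
  exact Real.smoothTransition.contDiff.comp
    (contDiff_const.mul (contDiff_const.sub (contDiff_norm_sq ℝ)))

lemma continuous_radialKer : Continuous (radialKer d c) :=
  (contDiff_radialKer (k := 0)).continuous

lemma hasCompactSupport_radialKer (hc : 0 < c) : HasCompactSupport (radialKer d c) := by
  apply HasCompactSupport.intro (isCompact_closedBall (0 : EuclideanSpace ℝ (Fin d)) 1)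
  intro y hy
  apply radialKer_eq_zero hc
  simp at hy
  exact hy.le

lemma integrable_radialKer (hc : 0 < c) : Integrable (radialKer d c) :=
  continuous_radialKer.integrable_of_hasCompactSupport (hasCompactSupport_radialKer hc)

lemma integral_pos_of_pos_on_ball {g : EuclideanSpace ℝ (Fin d) → ℝ} (hg : Continuous g)
    (hs : HasCompactSupport g) (h0 : ∀ y, 0 ≤ g y) (hp : 0 < g 0) : 0 < ∫ y, g y :=
  hg.integral_pos_of_hasCompactSupport_nonneg_nonzero hs h0 hp.ne'

lemma kerMass_pos (hc : 0 < c) : 0 < kerMass d c :=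
  integral_pos_of_pos_on_ball continuous_radialKer (hasCompactSupport_radialKer hc)
    radialKer_nonneg (radialKer_pos hc (by simp))

lemma hasDerivAt_potProfile (τ : ℝ) :
    HasDerivAt (potProfile c) (-(1 / 2) * Real.smoothTransition (c * (1 - τ))) τ := by
  have hcont : Continuous fun σ : ℝ => Real.smoothTransition (c * (1 - σ)) :=
    Real.smoothTransition.continuous.comp (by fun_prop)
  have := (intervalIntegral.integral_hasDerivAt_left (hcont.intervalIntegrable τ 1)
    (hcont.stronglyMeasurableAtFilter _ _) hcont.continuousAt).const_mul (1 / 2)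
  convert! this using 1
  ring

lemma hasFDerivAt_radialPot (y : EuclideanSpace ℝ (Fin d)) :
    HasFDerivAt (radialPot d c) (-(radialKer d c y) • innerSL ℝ y) y := by
  have h1 : HasFDerivAt (fun y : EuclideanSpace ℝ (Fin d) => ‖y‖ ^ 2) (2 • innerSL ℝ y) y :=
    (hasStrictFDerivAt_norm_sq y).hasFDerivAt
  have := (hasDerivAt_potProfile (c := c) (‖y‖ ^ 2)).comp_hasFDerivAt y h1
  convert! this using 1
  ext z
  simp [radialKer]
  ring

lemma fderiv_radialPot_single (y : EuclideanSpace ℝ (Fin d)) (i : Fin d) :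
    fderiv ℝ (radialPot d c) y (EuclideanSpace.single i 1) = -(y i * radialKer d c y) := by
  rw [(hasFDerivAt_radialPot y).fderiv]
  simp [EuclideanSpace.inner_single_right]
  ring

lemma continuous_radialPot : Continuous (radialPot d c) :=
  continuous_iff_continuousAt.2 fun y => (hasFDerivAt_radialPot y).continuousAt

lemma radialPot_eq_zero (hc : 0 < c) {y : EuclideanSpace ℝ (Fin d)} (hy : 1 ≤ ‖y‖) :
    radialPot d c y = 0 := by
  have h1 : 1 ≤ ‖y‖ ^ 2 := one_le_pow₀ hy
  unfold radialPot potProfile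
  rw [intervalIntegral.integral_symm, intervalIntegral.integral_of_le h1,
    setIntegral_eq_zero_of_forall_eq_zero]
  · simp
  · intro σ hσ
    apply Real.smoothTransition.zero_of_nonpos
    have := hσ.1
    nlinarith

lemma radialPot_nonneg (hc : 0 < c) (y : EuclideanSpace ℝ (Fin d)) : 0 ≤ radialPot d c y := by
  by_cases hy : 1 ≤ ‖y‖
  · rw [radialPot_eq_zero hc hy]
  · have h1 : ‖y‖ ^ 2 ≤ 1 := pow_le_one₀ (norm_nonneg y) (le_of_not_ge hy)
    exact mul_nonneg (by norm_num) (intervalIntegral.integral_nonneg h1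
      fun σ _ => Real.smoothTransition.nonneg _)

lemma hasCompactSupport_radialPot (hc : 0 < c) : HasCompactSupport (radialPot d c) := by
  apply HasCompactSupport.intro (isCompact_closedBall (0 : EuclideanSpace ℝ (Fin d)) 1)
  intro y hy
  apply radialPot_eq_zero hc
  simp at hy
  exact hy.le

lemma potMass_pos (hc : 0 < c) : 0 < potMass d c := by
  apply integral_pos_of_pos_on_ball continuous_radialPot (hasCompactSupport_radialPot hc)
    (radialPot_nonneg hc)
  refine mul_pos (by norm_num) ?_
  apply intervalIntegral.intervalIntegral_pos_of_pos_on
  · exact (Real.smoothTransition.continuous.comp (by fun_prop)).intervalIntegrable _ _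
  · intro σ hσ
    exact Real.smoothTransition.pos_of_pos (mul_pos hc (by linarith [hσ.2]))
  · simp

end Kernel

section MeanValue

variable {d : ℕ} {c : ℝ}

lemma hasDerivAt_integral_scale {g K : EuclideanSpace ℝ (Fin d) → ℝ} (hg : ContDiff ℝ 1 g)
    (hK : Continuous K) (hKs : HasCompactSupport K) (x : EuclideanSpace ℝ (Fin d)) (s : ℝ) :
    HasDerivAt (fun s : ℝ => ∫ y, g (x + s • y) * K y)
      (∫ y, fderiv ℝ g (x + s • y) y * K y) s := by
  have hg' : Continuous (fderiv ℝ g) := hg.continuous_fderiv one_ne_zero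
  have hgc := hg.continuous
  have hF' : Continuous fun p : ℝ × EuclideanSpace ℝ (Fin d) =>
      fderiv ℝ g (x + p.1 • p.2) p.2 * K p.2 :=
    ((hg'.comp (by fun_prop :
      Continuous fun p : ℝ × EuclideanSpace ℝ (Fin d) => x + p.1 • p.2)).clm_apply continuous_snd).mul (hK.comp continuous_snd)
  obtain ⟨C, hC⟩ := ((isCompact_closedBall s 1).prod hKs.isCompact).exists_bound_of_continuousOn
    (f := fun p : ℝ × EuclideanSpace ℝ (Fin d) =>
      fderiv ℝ g (x + p.1 • p.2) p.2 * K p.2) hF'.continuousOn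
  refine (hasDerivAt_integral_of_dominated_loc_of_deriv_le (𝕜 := ℝ) (μ := volume)
    (F := fun σ y => g (x + σ • y) * K y)
    (F' := fun σ y => fderiv ℝ g (x + σ • y) y * K y) (s := closedBall s 1)
    (bound := (tsupport K).indicator fun _ => C)
    (closedBall_mem_nhds s one_pos) ?_ ?_ ?_ ?_ ?_ ?_).2
  · exact Eventually.of_forall fun σ =>
      ((hgc.comp (by fun_prop : Continuous fun y => x + σ • y)).mul hK).aestronglyMeasurable
  · exact ((hgc.comp (by fun_prop : Continuous fun y => x + s • y)).mul hK).integrable_of_hasCompactSupport hKs.mul_left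
  · exact (hF'.comp (by fun_prop : Continuous fun y => (s, y))).aestronglyMeasurable
  · refine Eventually.of_forall fun y σ hσ => ?_
    by_cases hy : y ∈ tsupport K
    · rw [indicator_of_mem hy]
      exact hC (σ, y) ⟨hσ, hy⟩
    · rw [indicator_of_notMem hy, image_eq_zero_of_notMem_tsupport hy]
      simp
  · rw [integrable_indicator_iff (isClosed_tsupport K).measurableSet]
    exact integrableOn_const hKs.isCompact.measure_lt_top.ne
  · refine Eventually.of_forall fun y σ _ => ?_
    have h1 : HasDerivAt (fun σ : ℝ => x + σ • y) y σ := by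
      simpa using ((hasDerivAt_id σ).smul_const y).const_add x
    exact (((hg.differentiable one_ne_zero _).hasFDerivAt.comp_hasDerivAt σ h1)).mul_const (K y)

lemma contDiff_fderiv_single {g : EuclideanSpace ℝ (Fin d) → ℝ} (hg : ContDiff ℝ 2 g)
    (i : Fin d) : ContDiff ℝ 1 fun y => fderiv ℝ g y (EuclideanSpace.single i 1) :=
  (hg.fderiv_right (m := 1) (by norm_num)).clm_apply contDiff_const

lemma continuous_lapl {g : EuclideanSpace ℝ (Fin d) → ℝ} (hg : ContDiff ℝ 2 g) :
    Continuous (lapl d g) := by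
  unfold lapl
  refine continuous_finsetSum _ fun i _ => ?_
  exact ((contDiff_fderiv_single hg i).continuous_fderiv one_ne_zero).clm_apply
    continuous_const

lemma integral_fderiv_mul_radialKer {g : EuclideanSpace ℝ (Fin d) → ℝ} (hg : ContDiff ℝ 2 g)
    (hc : 0 < c) (x : EuclideanSpace ℝ (Fin d)) (s : ℝ) :
    ∫ y, fderiv ℝ g (x + s • y) y * radialKer d c y =
      s * ∫ y, lapl d g (x + s • y) * radialPot d c y := by
  have hker := hasCompactSupport_radialKer (d := d) hc
  have hpot := hasCompactSupport_radialPot (d := d) hc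
  have hD : ∀ i : Fin d, ∀ y, HasFDerivAt
      (fun y => fderiv ℝ g (x + s • y) (EuclideanSpace.single i 1))
      ((fderiv ℝ (fun z => fderiv ℝ g z (EuclideanSpace.single i 1)) (x + s • y)).comp
        (s • ContinuousLinearMap.id ℝ _)) y := by
    intro i y
    have h1 : HasFDerivAt (fun y : EuclideanSpace ℝ (Fin d) => x + s • y)
        (s • ContinuousLinearMap.id ℝ _) y :=
      ((hasFDerivAt_id y).const_smul s).const_add x
    exact (((contDiff_fderiv_single hg i).differentiable one_ne_zero _).hasFDerivAt).comp y h1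
  have hc1 : ∀ i : Fin d, Continuous fun y =>
      fderiv ℝ g (x + s • y) (EuclideanSpace.single i 1) := fun i =>
    (contDiff_fderiv_single hg i).continuous.comp (by fun_prop)
  have hc2 : ∀ i : Fin d, Continuous fun y =>
      fderiv ℝ (fun z => fderiv ℝ g z (EuclideanSpace.single i 1)) (x + s • y)
        (EuclideanSpace.single i 1) := fun i =>
    (((contDiff_fderiv_single hg i).continuous_fderiv one_ne_zero).clm_apply
      continuous_const).comp (by fun_prop : Continuous fun y => x + s • y)
  have hcoord : ∀ i : Fin d, Continuous fun y : EuclideanSpace ℝ (Fin d) => y i := fun i => by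
    fun_prop
  have hparts : ∀ i : Fin d,
      ∫ y, fderiv ℝ g (x + s • y) (EuclideanSpace.single i 1) * (y i * radialKer d c y) =
      ∫ y, s * (fderiv ℝ (fun z => fderiv ℝ g z (EuclideanSpace.single i 1)) (x + s • y)
        (EuclideanSpace.single i 1) * radialPot d c y) := by
    intro i
    have key := integral_mul_fderiv_eq_neg_fderiv_mul_of_integrable
      (μ := (volume : Measure (EuclideanSpace ℝ (Fin d)))) (𝕜 := ℝ)
      (f := fun y => fderiv ℝ g (x + s • y) (EuclideanSpace.single i 1))
      (g := radialPot d c) (v := EuclideanSpace.single i 1) ?_ ?_ ?_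
      (fun y _ => (hD i y).differentiableAt)
      (fun y _ => (hasFDerivAt_radialPot y).differentiableAt)
    · simp only [fderiv_radialPot_single, (hD i _).fderiv, mul_neg, integral_neg,
        neg_inj] at key
      rw [key]
      congr 1
      ext y
      simp
      ring
    · simp only [(hD i _).fderiv]
      refine Continuous.integrable_of_hasCompactSupport ?_ hpot.mul_left
      refine Continuous.mul ?_ continuous_radialPot
      simpa using (hc2 i).const_mul s
    · simp only [fderiv_radialPot_single]
      refine Continuous.integrable_of_hasCompactSupport ?_ ?_
      · exact (hc1 i).mul ((hcoord i).mul continuous_radialKer).neg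
      · simp only [mul_neg]
        exact (hker.mul_left.mul_left).neg
    · exact ((hc1 i).mul continuous_radialPot).integrable_of_hasCompactSupport hpot.mul_left
  have hexp : ∀ y : EuclideanSpace ℝ (Fin d), fderiv ℝ g (x + s • y) y * radialKer d c y =
      ∑ i, fderiv ℝ g (x + s • y) (EuclideanSpace.single i 1) * (y i * radialKer d c y) := by
    intro y
    have : y = ∑ i, y i • EuclideanSpace.single i (1 : ℝ) := by
      ext j
      simp [Pi.single_apply]
    conv_lhs => rw [show fderiv ℝ g (x + s • y) y =
      fderiv ℝ g (x + s • y) (∑ i, y i • EuclideanSpace.single i (1 : ℝ)) by rw [← this]]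
    rw [map_sum, Finset.sum_mul]
    refine Finset.sum_congr rfl fun i _ => ?_
    rw [map_smul, smul_eq_mul]
    ring
  simp_rw [hexp]
  rw [integral_finsetSum, Finset.sum_congr rfl fun i _ => hparts i, ← integral_finsetSum,
    ← integral_const_mul]
  · congr 1
    ext y
    rw [lapl, Finset.sum_mul, Finset.mul_sum]
  · intro i _
    exact (((hc2 i).mul continuous_radialPot).integrable_of_hasCompactSupport
      hpot.mul_left).const_mul s
  · intro i _
    exact ((hc1 i).mul ((hcoord i).mul continuous_radialKer)).integrable_of_hasCompactSupport
      hker.mul_left.mul_left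

lemma le_kerAvg_of_le_lapl {g : EuclideanSpace ℝ (Fin d) → ℝ} (hg : ContDiff ℝ 2 g)
    (hc : 0 < c) {x : EuclideanSpace ℝ (Fin d)} {s b : ℝ} (hs : 0 ≤ s)
    (hb : ∀ z ∈ closedBall x s, b ≤ lapl d g z) :
    kerMass d c * g x + b * potMass d c * (s ^ 2 / 2) ≤ kerAvg d c s g x := by
  have hpot := hasCompactSupport_radialPot (d := d) hc
  let F : ℝ → ℝ := fun σ => kerAvg d c σ g x - b * potMass d c * (σ ^ 2 / 2)
  have hF : ∀ σ, HasDerivAt F (σ * (∫ y, lapl d g (x + σ • y) * radialPot d c y) -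
      b * potMass d c * σ) σ := by
    intro σ
    have h1 := hasDerivAt_integral_scale (hg.of_le (by norm_num : (1 : WithTop ℕ∞) ≤ 2))
      continuous_radialKer (hasCompactSupport_radialKer hc) x σ
    rw [integral_fderiv_mul_radialKer hg hc] at h1
    have h2 : HasDerivAt (fun σ : ℝ => σ ^ 2 / 2) σ σ := by
      simpa using (hasDerivAt_pow 2 σ).div_const 2
    exact h1.sub (h2.const_mul _)
  have hmono : MonotoneOn F (Icc 0 s) := by
    refine monotoneOn_of_deriv_nonneg (convex_Icc 0 s)
      (fun σ _ => (hF σ).continuousAt.continuousWithinAt)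
      (fun σ _ => (hF σ).differentiableAt.differentiableWithinAt) fun σ hσ => ?_
    rw [interior_Icc] at hσ
    rw [(hF σ).deriv]
    have hint : b * potMass d c ≤ ∫ y, lapl d g (x + σ • y) * radialPot d c y := by
      rw [potMass, ← integral_const_mul]
      refine integral_mono
        ((continuous_radialPot.integrable_of_hasCompactSupport hpot).const_mul b)
        ((((continuous_lapl hg).comp (by fun_prop : Continuous fun y => x + σ • y)).mul
          continuous_radialPot).integrable_of_hasCompactSupport hpot.mul_left) fun y => ?_
      by_cases hy : 1 ≤ ‖y‖
      · simp [radialPot_eq_zero hc hy]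
      · refine mul_le_mul_of_nonneg_right (hb _ ?_) (radialPot_nonneg hc y)
        rw [mem_closedBall, dist_eq_norm, add_sub_cancel_left, norm_smul, Real.norm_eq_abs,
          abs_of_pos hσ.1]
        have := norm_nonneg y
        nlinarith [hσ.1, hσ.2]
    nlinarith [hσ.1]
  have h0 : F 0 = kerMass d c * g x := by
    simp [F, kerAvg, kerMass, integral_const_mul, mul_comm]
  have := hmono (left_mem_Icc.2 hs) (right_mem_Icc.2 hs) hs
  rw [h0] at this
  simp only [F] at this
  linarith

end MeanValue

/-- Convolution of two real functions on Euclidean space. -/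
def convR (d : ℕ) (V φ : EuclideanSpace ℝ (Fin d) → ℝ) (x : EuclideanSpace ℝ (Fin d)) : ℝ :=
  ∫ t, V t * φ (x - t)

section Convolution

variable {d : ℕ} {V φ : EuclideanSpace ℝ (Fin d) → ℝ}

lemma convR_eq_convolution :
    convR d V φ = convolution V φ (ContinuousLinearMap.mul ℝ ℝ) volume := by
  ext x
  simp [convR, convolution_def]

lemma convR_eq (x : EuclideanSpace ℝ (Fin d)) : convR d V φ x = ∫ y, V (x - y) * φ y := by
  rw [convR, ← integral_sub_left_eq_self _ volume x]
  simp

lemma contDiff_convR (hV : Continuous V) (hφ : ContDiff ℝ 2 φ) (hs : HasCompactSupport φ) :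
    ContDiff ℝ 2 (convR d V φ) := by
  rw [convR_eq_convolution]
  exact hs.contDiff_convolution_right (n := 2) _ hV.locallyIntegrable hφ

lemma fderiv_convR (hV : Continuous V) (hφ : ContDiff ℝ 1 φ) (hs : HasCompactSupport φ)
    (x v : EuclideanSpace ℝ (Fin d)) :
    fderiv ℝ (convR d V φ) x v = convR d V (fun y => fderiv ℝ φ y v) x := by
  rw [convR_eq_convolution, convR_eq_convolution,
    (hs.hasFDerivAt_convolution_right (ContinuousLinearMap.mul ℝ ℝ) hV.locallyIntegrable hφ
      x).fderiv]
  exact convolution_precompR_apply _ hV.locallyIntegrable (hs.fderiv ℝ)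
    (hφ.continuous_fderiv one_ne_zero) x v

lemma hasCompactSupport_fderiv_apply (hs : HasCompactSupport φ) (v : EuclideanSpace ℝ (Fin d)) :
    HasCompactSupport fun y => fderiv ℝ φ y v :=
  hs.fderiv_apply ℝ v

lemma hasCompactSupport_lapl (hs : HasCompactSupport φ) : HasCompactSupport (lapl d φ) := by
  refine HasCompactSupport.intro hs.isCompact fun y hy => ?_
  refine Finset.sum_eq_zero fun i _ => ?_
  have h := hasCompactSupport_fderiv_apply (hasCompactSupport_fderiv_apply hs
    (EuclideanSpace.single i 1)) (EuclideanSpace.single i 1)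
  have h1 : y ∉ tsupport fun z => fderiv ℝ φ z (EuclideanSpace.single i 1) :=
    fun hy' => hy (tsupport_fderiv_apply_subset ℝ _ hy')
  have h2 : y ∉ tsupport fun z => fderiv ℝ (fun z => fderiv ℝ φ z (EuclideanSpace.single i 1)) z
      (EuclideanSpace.single i 1) :=
    fun hy' => h1 (tsupport_fderiv_apply_subset ℝ _ hy')
  exact image_eq_zero_of_notMem_tsupport (f := fun z => fderiv ℝ
    (fun z => fderiv ℝ φ z (EuclideanSpace.single i 1)) z (EuclideanSpace.single i 1)) h2

lemma integrable_mul_conv (hV : Continuous V) (hφ : Continuous φ) (hs : HasCompactSupport φ)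
    (x : EuclideanSpace ℝ (Fin d)) : Integrable fun y => V (x - y) * φ y :=
  ((hV.comp (by fun_prop)).mul hφ).integrable_of_hasCompactSupport hs.mul_left

lemma lapl_convR (hV : Continuous V) (hφ : ContDiff ℝ 2 φ) (hs : HasCompactSupport φ)
    (x : EuclideanSpace ℝ (Fin d)) : lapl d (convR d V φ) x = convR d V (lapl d φ) x := by
  have h1 : ∀ i : Fin d, ContDiff ℝ 1 fun y => fderiv ℝ φ y (EuclideanSpace.single i 1) :=
    fun i => contDiff_fderiv_single hφ i
  have h2 := fun i : Fin d => hasCompactSupport_fderiv_apply hs (EuclideanSpace.single i 1)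
  rw [convR_eq]
  unfold lapl
  simp_rw [Finset.mul_sum]
  rw [integral_finsetSum]
  · refine Finset.sum_congr rfl fun i _ => ?_
    rw [funext fun y => fderiv_convR hV (hφ.of_le (by norm_num)) hs y (EuclideanSpace.single i 1),
      fderiv_convR hV (h1 i) (h2 i), convR_eq]
  · intro i _
    exact integrable_mul_conv hV (((h1 i).continuous_fderiv one_ne_zero).clm_apply
      continuous_const) (hasCompactSupport_fderiv_apply (h2 i) _) x

lemma kerAvg_convR {c r : ℝ} (hc : 0 < c) (hV : Continuous V) (hφ : Continuous φ)
    (hs : HasCompactSupport φ) (x : EuclideanSpace ℝ (Fin d)) :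
    kerAvg d c r (convR d V φ) x = ∫ t, kerAvg d c r V t * φ (x - t) := by
  have hsx : HasCompactSupport fun t => φ (x - t) := hs.comp_homeomorph (Homeomorph.subLeft x)
  have h1 : ∀ y, convR d V φ (x + r • y) * radialKer d c y =
      ∫ t, V (t + r • y) * φ (x - t) * radialKer d c y := by
    intro y
    rw [integral_mul_const, convR, ← integral_add_right_eq_self _ (r • y)]
    congr 2
    ext t
    rw [add_sub_add_right_eq_sub]
  simp_rw [kerAvg, h1]
  rw [integral_integral_swap_of_hasCompactSupport]
  · refine integral_congr_ae (Eventually.of_forall fun t => ?_)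
    simp only
    rw [← integral_mul_const]
    congr 1
    ext y
    ring
  · have := continuous_radialKer (d := d) (c := c)
    unfold Function.uncurry
    fun_prop
  · refine HasCompactSupport.intro
      ((hasCompactSupport_radialKer (d := d) hc).isCompact.prod hsx.isCompact) ?_
    rintro ⟨y, t⟩ h
    rw [mem_prod, not_and_or] at h
    rcases h with h | h
    · simp [Function.uncurry, image_eq_zero_of_notMem_tsupport h]
    · have := image_eq_zero_of_notMem_tsupport h
      simp [Function.uncurry, this]

lemma convR_lipschitz_bound (hV : Continuous V) (hφ : Continuous φ) (hs : HasCompactSupport φ)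
    {x z : EuclideanSpace ℝ (Fin d)} {e : ℝ} (h : ∀ y, |V (x - y) - V (z - y)| ≤ e) :
    |convR d V φ x - convR d V φ z| ≤ e * ∫ y, |φ y| := by
  rw [convR_eq, convR_eq, ← integral_sub (integrable_mul_conv hV hφ hs x)
    (integrable_mul_conv hV hφ hs z), ← integral_const_mul, ← Real.norm_eq_abs]
  refine norm_integral_le_of_norm_le
    ((hφ.integrable_of_hasCompactSupport hs).abs.const_mul e) (Eventually.of_forall fun y => ?_)
  rw [← sub_mul, norm_mul]
  exact mul_le_mul_of_nonneg_right (h y) (norm_nonneg _)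

lemma tendsto_convR {V : ℕ → EuclideanSpace ℝ (Fin d) → ℝ} {V₀ : EuclideanSpace ℝ (Fin d) → ℝ}
    {B : ℝ} (hV : ∀ j, Continuous (V j)) (hB : ∀ j x, |V j x| ≤ B)
    (hlim : ∀ x, Tendsto (fun j => V j x) atTop (𝓝 (V₀ x)))
    (hφ : Continuous φ) (hs : HasCompactSupport φ) (x : EuclideanSpace ℝ (Fin d)) :
    Tendsto (fun j => convR d (V j) φ x) atTop (𝓝 (convR d V₀ φ x)) := by
  simp_rw [convR_eq]
  refine tendsto_integral_of_dominated_convergence (fun y => B * |φ y|)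
    (fun j => (integrable_mul_conv (hV j) hφ hs x).aestronglyMeasurable)
    ((hφ.integrable_of_hasCompactSupport hs).abs.const_mul B)
    (fun j => Eventually.of_forall fun y => ?_)
    (Eventually.of_forall fun y => (hlim (x - y)).mul_const _)
  rw [norm_mul]
  exact mul_le_mul_of_nonneg_right (hB j _) (norm_nonneg _)

end Convolution

section Limits

variable {d : ℕ}

lemma integrable_kerAvg {c r B : ℝ} (hc : 0 < c) {w : EuclideanSpace ℝ (Fin d) → ℝ}
    (hw : Measurable w) (hB : ∀ x, |w x| ≤ B) (x : EuclideanSpace ℝ (Fin d)) :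
    Integrable fun y => w (x + r • y) * radialKer d c y :=
  (integrable_radialKer hc).bdd_mul (hw.comp (by fun_prop)).aestronglyMeasurable
    (Eventually.of_forall fun y => hB _)

lemma measurable_kerAvg {c r : ℝ} {w : EuclideanSpace ℝ (Fin d) → ℝ}
    (hw : Measurable w) : Measurable (kerAvg d c r w) := by
  have : StronglyMeasurable fun p : EuclideanSpace ℝ (Fin d) × EuclideanSpace ℝ (Fin d) =>
      w (p.1 + r • p.2) * radialKer d c p.2 :=
    ((hw.comp (by fun_prop)).mul
      (continuous_radialKer.measurable.comp measurable_snd)).stronglyMeasurable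
  exact this.integral_prod_right.measurable

lemma abs_kerAvg_le {c r B : ℝ} (hc : 0 < c) {w : EuclideanSpace ℝ (Fin d) → ℝ}
    (hB : ∀ x, |w x| ≤ B) (x : EuclideanSpace ℝ (Fin d)) :
    |kerAvg d c r w x| ≤ B * kerMass d c := by
  rw [kerAvg, kerMass, ← integral_const_mul, ← Real.norm_eq_abs]
  refine norm_integral_le_of_norm_le ((integrable_radialKer hc).const_mul B)
    (Eventually.of_forall fun y => ?_)
  rw [norm_mul, Real.norm_of_nonneg (radialKer_nonneg y)]
  exact mul_le_mul_of_nonneg_right (hB _) (radialKer_nonneg y)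

lemma lapl_convR_nonpos {V : ℕ → EuclideanSpace ℝ (Fin d) → ℝ}
    {V₀ φ : EuclideanSpace ℝ (Fin d) → ℝ} {B c a : ℝ} {r : ℕ → ℝ} (hc : 0 < c)
    (hB : ∀ j x, |V j x| ≤ B) (hV : UniformEquicontinuous V)
    (hlim : ∀ x, Tendsto (fun j => V j x) atTop (𝓝 (V₀ x))) (hV₀ : Continuous V₀)
    (hr : ∀ j, 0 < r j) (hr0 : Tendsto r atTop (𝓝 0)) {z : EuclideanSpace ℝ (Fin d)}
    (hφ : ContDiff ℝ 2 φ) (hs : HasCompactSupport φ) (hφ0 : ∀ y, 0 ≤ φ y)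
    (hφa : ∀ y, a ≤ ‖y‖ → φ y = 0)
    (hsup : ∀ᶠ j in atTop, ∀ t ∈ ball z a,
      kerAvg d c (r j) (V j) t ≤ kerMass d c * V j t) :
    lapl d (convR d V₀ φ) z ≤ 0 := by
  by_contra! hpos
  have hVc : ∀ j, Continuous (V j) := fun j => (hV.uniformContinuous j).continuous
  have hψ := continuous_lapl hφ
  have hψs := hasCompactSupport_lapl hs
  set A := lapl d (convR d V₀ φ) z with hA
  have ht : Tendsto (fun j => lapl d (convR d (V j) φ) z) atTop (𝓝 A) := by
    rw [hA, lapl_convR hV₀ hφ hs]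
    simp_rw [fun j => lapl_convR (hVc j) hφ hs z]
    exact tendsto_convR hVc hB hlim hψ hψs z
  set I := ∫ y, |lapl d φ y| with hI
  have hI0 : 0 ≤ I := integral_nonneg fun y => abs_nonneg _
  obtain ⟨δ, hδ, hδ'⟩ := Metric.uniformEquicontinuous_iff.1 hV (A / (4 * (I + 1))) (by positivity)
  obtain ⟨j, hj1, hj2, hj3⟩ := (hsup.and ((ht.eventually (lt_mem_nhds (half_lt_self hpos))).and
    (hr0.eventually (gt_mem_nhds hδ)))).exists
  have hlow : ∀ z' ∈ closedBall z (r j), A / 4 ≤ lapl d (convR d (V j) φ) z' := by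
    intro z' hz'
    have hb := convR_lipschitz_bound (hVc j) hψ hψs (x := z') (z := z)
      (e := A / (4 * (I + 1))) fun y => by
        refine (hδ' (z' - y) (z - y) ?_ j).le
        rw [dist_sub_right]
        exact lt_of_le_of_lt hz' hj3
    rw [← lapl_convR (hVc j) hφ hs, ← lapl_convR (hVc j) hφ hs] at hb
    have h4 : A / (4 * (I + 1)) * I ≤ A / 4 := by
      rw [div_mul_eq_mul_div, div_le_div_iff₀ (by positivity) (by norm_num)]
      nlinarith
    have := (abs_le.1 (hb.trans h4)).1
    linarith
  have h1 := le_kerAvg_of_le_lapl (contDiff_convR (hVc j) hφ hs) hc (hr j).le hlow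
  have h2 : kerAvg d c (r j) (convR d (V j) φ) z ≤ kerMass d c * convR d (V j) φ z := by
    rw [kerAvg_convR hc (hVc j) hφ.continuous hs, convR, ← integral_const_mul]
    have hsz : HasCompactSupport fun t => φ (z - t) := hs.comp_homeomorph (Homeomorph.subLeft z)
    have hφz : Integrable fun t => φ (z - t) :=
      (hφ.continuous.comp (by fun_prop : Continuous fun t => z - t)).integrable_of_hasCompactSupport
        hsz
    refine integral_mono (hφz.bdd_mul (measurable_kerAvg (hVc j).measurable).aestronglyMeasurable
      (Eventually.of_forall fun t => abs_kerAvg_le hc (hB j) t))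
      ((hφz.bdd_mul (hVc j).aestronglyMeasurable
        (Eventually.of_forall fun t => hB j t)).const_mul _) fun t => ?_
    simp only
    rw [← mul_assoc]
    by_cases ht : ‖z - t‖ < a
    · refine mul_le_mul_of_nonneg_right (hj1 t ?_) (hφ0 _)
      rwa [mem_ball, dist_comm, dist_eq_norm]
    · simp [hφa _ (le_of_not_gt ht)]
  have h3 : 0 < A / 4 * potMass d c * (r j ^ 2 / 2) := by
    have := potMass_pos (d := d) hc
    have := hr j
    positivity
  linarith

end Limits

section Averages

variable {d : ℕ} {c : ℝ}

lemma continuous_integral_radialKer {X : Type*} [TopologicalSpace X]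
    [FirstCountableTopology X] [LocallyCompactSpace X] (hc : 0 < c)
    {F : X → EuclideanSpace ℝ (Fin d) → ℝ} (hF : Continuous (Function.uncurry F)) :
    Continuous fun p => ∫ y, F p y * radialKer d c y := by
  have h1 : ∀ p, ∫ y, F p y * radialKer d c y =
      ∫ y in closedBall 0 1, F p y * radialKer d c y := by
    intro p
    rw [setIntegral_eq_integral_of_forall_compl_eq_zero]
    intro y hy
    rw [radialKer_eq_zero hc, mul_zero]
    simp at hy
    exact hy.le
  simp_rw [h1]
  refine continuous_parametric_integral_of_continuous ?_ (isCompact_closedBall 0 1)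
  have := continuous_radialKer (d := d) (c := c)
  unfold Function.uncurry at *
  fun_prop

lemma continuous_kerAvg (hc : 0 < c) {V : EuclideanSpace ℝ (Fin d) → ℝ} (hV : Continuous V) :
    Continuous fun p : ℝ × EuclideanSpace ℝ (Fin d) => kerAvg d c p.1 V p.2 := by
  unfold kerAvg
  refine continuous_integral_radialKer hc
    (F := fun (p : ℝ × EuclideanSpace ℝ (Fin d)) y => V (p.2 + p.1 • y)) ?_
  unfold Function.uncurry
  fun_prop

lemma kerAvg_zero (V : EuclideanSpace ℝ (Fin d) → ℝ) (x : EuclideanSpace ℝ (Fin d)) :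
    kerAvg d c 0 V x = kerMass d c * V x := by
  simp [kerAvg, kerMass, integral_const_mul, mul_comm]

lemma kerAvg_neg (s : ℝ) (V : EuclideanSpace ℝ (Fin d) → ℝ) (x : EuclideanSpace ℝ (Fin d)) :
    kerAvg d c s (fun y => -V y) x = -kerAvg d c s V x := by
  simp [kerAvg, integral_neg]

lemma kerAvg_const_mul (s a : ℝ) (V : EuclideanSpace ℝ (Fin d) → ℝ)
    (x : EuclideanSpace ℝ (Fin d)) :
    kerAvg d c s (fun y => a * V y) x = a * kerAvg d c s V x := by
  simp [kerAvg, mul_assoc, integral_const_mul]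

lemma kerAvg_const (s a : ℝ) (x : EuclideanSpace ℝ (Fin d)) :
    kerAvg d c s (fun _ => a) x = kerMass d c * a := by
  simp [kerAvg, kerMass, integral_const_mul, mul_comm]

lemma integrable_kerAvg_of_continuous (hc : 0 < c) {V : EuclideanSpace ℝ (Fin d) → ℝ}
    (hV : Continuous V) (s : ℝ) (x : EuclideanSpace ℝ (Fin d)) :
    Integrable fun y => V (x + s • y) * radialKer d c y :=
  ((hV.comp (by fun_prop)).mul continuous_radialKer).integrable_of_hasCompactSupport
    (hasCompactSupport_radialKer hc).mul_left

lemma kerAvg_add (hc : 0 < c) {V W : EuclideanSpace ℝ (Fin d) → ℝ} (hV : Continuous V)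
    (hW : Continuous W) (s : ℝ) (x : EuclideanSpace ℝ (Fin d)) :
    kerAvg d c s (fun y => V y + W y) x = kerAvg d c s V x + kerAvg d c s W x := by
  rw [kerAvg, kerAvg, kerAvg, ← integral_add (integrable_kerAvg_of_continuous hc hV s x)
    (integrable_kerAvg_of_continuous hc hW s x)]
  simp_rw [add_mul]

lemma kerAvg_congr (hc : 0 < c) {V W : EuclideanSpace ℝ (Fin d) → ℝ} {s : ℝ} (hs : 0 < s)
    {x : EuclideanSpace ℝ (Fin d)} (h : ∀ z ∈ ball x s, V z = W z) :
    kerAvg d c s V x = kerAvg d c s W x := by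
  unfold kerAvg
  congr 1
  ext y
  by_cases hy : 1 ≤ ‖y‖
  · simp [radialKer_eq_zero hc hy]
  · rw [h]
    simp only [mem_ball, dist_self_add_left, norm_smul, Real.norm_of_nonneg hs.le]
    nlinarith

lemma kerAvg_mono (hc : 0 < c) {V W : EuclideanSpace ℝ (Fin d) → ℝ} {s : ℝ} (hs : 0 < s)
    {x : EuclideanSpace ℝ (Fin d)}
    (hV : Integrable fun y => V (x + s • y) * radialKer d c y)
    (hW : Integrable fun y => W (x + s • y) * radialKer d c y)
    (h : ∀ z ∈ ball x s, V z ≤ W z) :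
    kerAvg d c s V x ≤ kerAvg d c s W x := by
  refine integral_mono hV hW fun y => ?_
  by_cases hy : 1 ≤ ‖y‖
  · simp [radialKer_eq_zero hc hy]
  · refine mul_le_mul_of_nonneg_right (h _ ?_) (radialKer_nonneg y)
    simp only [mem_ball, dist_self_add_left, norm_smul, Real.norm_of_nonneg hs.le]
    nlinarith

lemma lapl_neg (g : EuclideanSpace ℝ (Fin d) → ℝ) (x : EuclideanSpace ℝ (Fin d)) :
    lapl d (fun y => -g y) x = -lapl d g x := by
  simp_rw [lapl, ← Finset.sum_neg_distrib]
  refine Finset.sum_congr rfl fun i _ => ?_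
  rw [funext fun y => congrArg (fun L : EuclideanSpace ℝ (Fin d) →L[ℝ] ℝ =>
    L (EuclideanSpace.single i 1)) (fderiv_fun_neg (f := g) (x := y))]
  simp only [_root_.neg_apply]
  rw [fderiv_fun_neg, _root_.neg_apply]

lemma lapl_congr {f g : EuclideanSpace ℝ (Fin d) → ℝ} {x : EuclideanSpace ℝ (Fin d)}
    (h : f =ᶠ[𝓝 x] g) : lapl d f x = lapl d g x := by
  refine Finset.sum_congr rfl fun i _ => ?_
  refine congrArg (fun L : EuclideanSpace ℝ (Fin d) →L[ℝ] ℝ => L (EuclideanSpace.single i 1))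
    (Filter.EventuallyEq.fderiv_eq (𝕜 := ℝ) ?_)
  filter_upwards [h.fderiv (𝕜 := ℝ)] with y hy
  rw [hy]

lemma kerAvg_le_of_lapl_nonpos {g : EuclideanSpace ℝ (Fin d) → ℝ} (hg : ContDiff ℝ 2 g)
    (hc : 0 < c) {x : EuclideanSpace ℝ (Fin d)} {s : ℝ} (hs : 0 ≤ s)
    (hb : ∀ z ∈ closedBall x s, lapl d g z ≤ 0) : kerAvg d c s g x ≤ kerMass d c * g x := by
  have := le_kerAvg_of_le_lapl hg.neg hc hs (b := 0) fun z hz => by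
    have := lapl_neg g z
    have := hb z hz
    linarith
  simp only [kerAvg_neg] at this
  linarith

lemma kerAvg_eq_of_lapl_eq_zero {g : EuclideanSpace ℝ (Fin d) → ℝ} (hg : ContDiff ℝ 2 g)
    (hc : 0 < c) {x : EuclideanSpace ℝ (Fin d)} {s : ℝ} (hs : 0 ≤ s)
    (hb : ∀ z, lapl d g z = 0) : kerAvg d c s g x = kerMass d c * g x := by
  refine le_antisymm (kerAvg_le_of_lapl_nonpos hg hc hs fun z _ => (hb z).le) ?_
  have := le_kerAvg_of_le_lapl hg hc hs (x := x) (b := 0) fun z _ => (hb z).ge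
  linarith

lemma lapl_nonpos_of_kerAvg_le {g : EuclideanSpace ℝ (Fin d) → ℝ} (hg : ContDiff ℝ 2 g)
    (hc : 0 < c) {x : EuclideanSpace ℝ (Fin d)} {a : ℝ} (ha : 0 < a)
    (h : ∀ s, 0 < s → s < a → kerAvg d c s g x ≤ kerMass d c * g x) : lapl d g x ≤ 0 := by
  by_contra! hpos
  obtain ⟨e, he, he'⟩ := Metric.nhds_basis_closedBall.eventually_iff.1
    ((continuous_lapl hg).continuousAt.eventually (lt_mem_nhds (half_lt_self hpos)))
  have hs : 0 < min e (a / 2) := lt_min he (by positivity)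
  have h1 := le_kerAvg_of_le_lapl hg hc hs.le (x := x) (b := lapl d g x / 2) fun z hz =>
    (he' (closedBall_subset_closedBall (min_le_left _ _) hz)).le
  have h2 := h _ hs ((min_le_right _ _).trans_lt (by linarith))
  have h3 : 0 < lapl d g x / 2 * potMass d c * (min e (a / 2) ^ 2 / 2) := by
    have := potMass_pos (d := d) hc
    positivity
  linarith

/-- The kernel rescaled to radius `ε`. -/
def scaledKer (d : ℕ) (ε : ℝ) (y : EuclideanSpace ℝ (Fin d)) : ℝ := radialKer d 1 (ε⁻¹ • y)

lemma contDiff_scaledKer (ε : ℝ) : ContDiff ℝ 2 (scaledKer d ε) :=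
  (contDiff_radialKer (k := 2)).comp (contDiff_const_smul _)

lemma scaledKer_nonneg (ε : ℝ) (y : EuclideanSpace ℝ (Fin d)) : 0 ≤ scaledKer d ε y :=
  radialKer_nonneg _

lemma scaledKer_eq_zero {ε : ℝ} (hε : 0 < ε) {y : EuclideanSpace ℝ (Fin d)} (hy : ε ≤ ‖y‖) :
    scaledKer d ε y = 0 := by
  refine radialKer_eq_zero one_pos ?_
  rw [norm_smul, norm_inv, Real.norm_of_nonneg hε.le, inv_mul_eq_div, one_le_div hε]
  exact hy

lemma hasCompactSupport_scaledKer {ε : ℝ} (hε : 0 < ε) : HasCompactSupport (scaledKer d ε) := by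
  refine HasCompactSupport.intro (isCompact_closedBall (0 : EuclideanSpace ℝ (Fin d)) ε)
    fun y hy => scaledKer_eq_zero hε ?_
  simp at hy
  exact hy.le

lemma kerAvg_eq_convR {ε : ℝ} (hε : 0 < ε) (V : EuclideanSpace ℝ (Fin d) → ℝ)
    (x : EuclideanSpace ℝ (Fin d)) :
    kerAvg d 1 ε V x = (ε ^ d)⁻¹ * convR d V (scaledKer d ε) x := by
  have h := Measure.integral_comp_smul (volume : Measure (EuclideanSpace ℝ (Fin d)))
    (fun y => V (x - y) * scaledKer d ε y) (-ε)
  rw [convR_eq]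
  have h1 : |((-ε) ^ d)⁻¹| = (ε ^ d)⁻¹ := by
    rw [abs_inv, abs_pow, abs_neg, abs_of_pos hε]
  rw [finrank_euclideanSpace_fin, smul_eq_mul, h1] at h
  rw [← h, kerAvg]
  congr 1
  ext y
  simp [scaledKer, radialKer, hε.ne']

lemma contDiff_kerAvg {ε : ℝ} (hε : 0 < ε) {V : EuclideanSpace ℝ (Fin d) → ℝ}
    (hV : Continuous V) : ContDiff ℝ 2 (kerAvg d 1 ε V) := by
  rw [funext (kerAvg_eq_convR hε V)]
  exact contDiff_const.mul
    (contDiff_convR hV (contDiff_scaledKer ε) (hasCompactSupport_scaledKer hε))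

lemma kerAvg_le_of_mollified {V : EuclideanSpace ℝ (Fin d) → ℝ} (hV : Continuous V)
    (hc : 0 < c) {x : EuclideanSpace ℝ (Fin d)} {s a : ℝ} (hs : 0 ≤ s) (ha : 0 < a)
    (h : ∀ ε, 0 < ε → ε < a → ∀ z ∈ closedBall x s, lapl d (convR d V (scaledKer d ε)) z ≤ 0) :
    kerAvg d c s V x ≤ kerMass d c * V x := by
  have h1 : ∀ ε, 0 < ε → ε < a →
      kerAvg d c s (kerAvg d 1 ε V) x ≤ kerMass d c * kerAvg d 1 ε V x := by
    intro ε hε hεa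
    rw [funext (kerAvg_eq_convR hε V), kerAvg_const_mul, mul_left_comm]
    exact mul_le_mul_of_nonneg_left (kerAvg_le_of_lapl_nonpos (contDiff_convR hV
      (contDiff_scaledKer ε) (hasCompactSupport_scaledKer hε)) hc hs (h ε hε hεa)) (by positivity)
  have hcont := continuous_kerAvg (d := d) one_pos hV
  have hL : Continuous fun ε : ℝ => kerAvg d c s (kerAvg d 1 ε V) x := by
    refine continuous_integral_radialKer hc
      (F := fun (ε : ℝ) y => kerAvg d 1 ε V (x + s • y)) ?_
    exact hcont.comp (f := fun p : ℝ × EuclideanSpace ℝ (Fin d) => (p.1, x + s • p.2))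
      (by fun_prop)
  have hR : Continuous fun ε : ℝ => kerMass d c * kerAvg d 1 ε V x :=
    continuous_const.mul (hcont.comp (f := fun p : ℝ => (p, x)) (by fun_prop))
  have h2 := le_of_tendsto_of_tendsto ((hL.tendsto 0).mono_left nhdsWithin_le_nhds)
    ((hR.tendsto 0).mono_left nhdsWithin_le_nhds) (b := 𝓝[>] 0) (by
      filter_upwards [Ioo_mem_nhdsGT ha] with ε hε using h1 ε hε.1 hε.2)
  simp only [kerAvg_zero] at h2
  rw [funext (kerAvg_zero V), kerAvg_const_mul, mul_left_comm] at h2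
  exact le_of_mul_le_mul_left h2 (kerMass_pos one_pos)

lemma tendsto_radialKer (y : EuclideanSpace ℝ (Fin d)) :
    Tendsto (fun j : ℕ => radialKer d (j + 1) y) atTop
      (𝓝 ((ball (0 : EuclideanSpace ℝ (Fin d)) 1).indicator 1 y)) := by
  by_cases hy : y ∈ ball (0 : EuclideanSpace ℝ (Fin d)) 1
  · rw [indicator_of_mem hy]
    have hy1 : 0 < 1 - ‖y‖ ^ 2 := by
      rw [mem_ball_zero_iff] at hy
      have := norm_nonneg y
      nlinarith
    obtain ⟨N, hN⟩ := exists_nat_gt (1 / (1 - ‖y‖ ^ 2))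
    refine tendsto_const_nhds.congr' ?_
    filter_upwards [eventually_ge_atTop N] with j hj
    refine (Real.smoothTransition.one_of_one_le ?_).symm
    have : (N : ℝ) ≤ j := by exact_mod_cast hj
    rw [div_lt_iff₀ hy1] at hN
    nlinarith
  · rw [indicator_of_notMem hy]
    refine tendsto_const_nhds.congr fun j => (radialKer_eq_zero (by positivity) ?_).symm
    simpa using hy

lemma tendsto_kerAvg_ball {u : EuclideanSpace ℝ (Fin d) → ℝ} (hu : Continuous u)
    (x : EuclideanSpace ℝ (Fin d)) (s : ℝ) :
    Tendsto (fun j : ℕ => kerAvg d (j + 1) s u x) atTop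
      (𝓝 (∫ y in ball 0 1, u (x + s • y))) := by
  rw [← integral_indicator measurableSet_ball]
  have hu' : Continuous fun y => u (x + s • y) := by fun_prop
  refine tendsto_integral_of_dominated_convergence
    ((closedBall 0 1).indicator fun y => |u (x + s • y)|)
    (fun j => (hu'.mul continuous_radialKer).aestronglyMeasurable) ?_ (fun j => ?_) ?_
  · rw [integrable_indicator_iff measurableSet_closedBall]
    exact hu'.abs.continuousOn.integrableOn_compact (isCompact_closedBall 0 1)
  · refine Eventually.of_forall fun y => ?_
    by_cases hy : y ∈ closedBall (0 : EuclideanSpace ℝ (Fin d)) 1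
    · rw [indicator_of_mem hy, norm_mul, Real.norm_of_nonneg (radialKer_nonneg y)]
      exact mul_le_of_le_one_right (abs_nonneg _) (radialKer_le_one y)
    · rw [indicator_of_notMem hy, radialKer_eq_zero (by positivity)]
      · simp
      · simp at hy
        exact hy.le
  · refine Eventually.of_forall fun y => ?_
    have := (tendsto_radialKer y).const_mul (u (x + s • y))
    convert this using 2
    by_cases hy : y ∈ ball (0 : EuclideanSpace ℝ (Fin d)) 1 <;> simp [hy]

lemma setIntegral_ball_comp (u : EuclideanSpace ℝ (Fin d) → ℝ) (x : EuclideanSpace ℝ (Fin d))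
    {s : ℝ} (hs : 0 < s) :
    ∫ y in ball 0 1, u (x + s • y) = (s ^ d)⁻¹ * ∫ y in ball x s, u y := by
  have h := Measure.setIntegral_comp_smul_of_pos (volume : Measure (EuclideanSpace ℝ (Fin d)))
    (fun y => u (x + y)) (ball 0 1) hs
  rw [h, finrank_euclideanSpace_fin, smul_eq_mul, _root_.smul_ball hs.ne', Real.norm_of_nonneg hs.le]
  congr 1
  rw [← integral_indicator measurableSet_ball, ← integral_indicator measurableSet_ball,
    ← integral_add_left_eq_self ((ball x s).indicator u) x]
  congr 1
  ext y
  simp only [indicator, mem_ball, dist_self_add_left, smul_zero, mul_one, dist_zero_right]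

lemma superMeanVal_of_kerAvg_le {u : EuclideanSpace ℝ (Fin d) → ℝ} (hu : Continuous u)
    (h : ∀ c s x, 0 < c → 0 < s → kerAvg d c s u x ≤ kerMass d c * u x) : SuperMeanVal d u := by
  intro x s hs
  have h1 := le_of_tendsto_of_tendsto' (tendsto_kerAvg_ball hu x s)
    (tendsto_kerAvg_ball (continuous_const (y := u x)) x s) fun j => by
      rw [kerAvg_const]
      exact h _ s x (by positivity) hs
  rw [setIntegral_ball_comp u x hs, setIntegral_ball_comp (fun _ => u x) x hs] at h1
  have h2 := le_of_mul_le_mul_left h1 (by positivity)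
  have hvol : 0 < volume.real (ball x s) :=
    ENNReal.toReal_pos (measure_ball_pos _ _ hs).ne' measure_ball_lt_top.ne
  rw [setIntegral_const, smul_eq_mul] at h2
  rw [setAverage_eq, smul_eq_mul, inv_mul_le_iff₀ hvol]
  exact h2

lemma harmonic_of_kerAvg_eq {V : EuclideanSpace ℝ (Fin d) → ℝ} (hV : Continuous V)
    {x₀ : EuclideanSpace ℝ (Fin d)} {a : ℝ} (ha : 0 < a)
    (h : ∀ x ∈ ball x₀ a, ∀ s, 0 < s → s < a → kerAvg d 1 s V x = kerMass d 1 * V x) :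
    ContDiffAt ℝ 2 V x₀ ∧ lapl d V x₀ = 0 := by
  have hm := kerMass_pos (d := d) (c := 1) one_pos
  set g : EuclideanSpace ℝ (Fin d) → ℝ :=
    fun x => (kerMass d 1)⁻¹ * kerAvg d 1 (a / 2) V x with hg
  have hgc : ContDiff ℝ 2 g := contDiff_const.mul (contDiff_kerAvg (by positivity) hV)
  have hgV : ∀ x ∈ ball x₀ a, V x = g x := by
    intro x hx
    rw [hg]
    simp only
    rw [h x hx _ (by positivity) (by linarith), inv_mul_cancel_left₀ hm.ne']
  have hev : V =ᶠ[𝓝 x₀] g := by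
    filter_upwards [ball_mem_nhds x₀ ha] with x hx using hgV x hx
  have hk : ∀ s, 0 < s → s < a → kerAvg d 1 s g x₀ = kerMass d 1 * g x₀ := by
    intro s hs hsa
    rw [← hgV x₀ (mem_ball_self ha), ← h x₀ (mem_ball_self ha) s hs hsa]
    exact kerAvg_congr one_pos hs fun z hz => (hgV z (ball_subset_ball hsa.le hz)).symm
  refine ⟨hgc.contDiffAt.congr_of_eventuallyEq hev, ?_⟩
  rw [lapl_congr hev]
  refine le_antisymm (lapl_nonpos_of_kerAvg_le hgc one_pos ha fun s hs hsa => (hk s hs hsa).le) ?_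
  have := lapl_nonpos_of_kerAvg_le hgc.neg one_pos ha (x := x₀) fun s hs hsa => by
    simp only [kerAvg_neg, hk s hs hsa]
    linarith
  simp only [lapl_neg] at this
  linarith

end Averages

/-- Bounded measurable functions above `ψ` satisfying the discrete super-mean-value inequality
at scale `r`. -/
structure SuperClass (d : ℕ) (r : ℝ) (ψ w : EuclideanSpace ℝ (Fin d) → ℝ) : Prop where
  measurable : Measurable w
  bounded : ∃ B, ∀ x, |w x| ≤ B
  le : ∀ x, ψ x ≤ w x
  super : ∀ x, kerAvg d 1 r w x ≤ kerMass d 1 * w x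

/-- The lower envelope of `SuperClass`. -/
def lowerEnv (d : ℕ) (r : ℝ) (ψ : EuclideanSpace ℝ (Fin d) → ℝ) (x : EuclideanSpace ℝ (Fin d)) :
    ℝ :=
  ⨅ w : {w // SuperClass d r ψ w}, w.1 x

section Envelope

variable {d : ℕ} {r : ℝ} {ψ : EuclideanSpace ℝ (Fin d) → ℝ}

lemma superClass_one (h1 : ∀ x, ψ x ≤ 1) : SuperClass d r ψ fun _ => 1 where
  measurable := measurable_const
  bounded := ⟨1, by simp⟩
  le := h1
  super x := (kerAvg_const _ _ _).le

lemma lowerEnv_le {w : EuclideanSpace ℝ (Fin d) → ℝ} (hw : SuperClass d r ψ w)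
    (x : EuclideanSpace ℝ (Fin d)) : lowerEnv d r ψ x ≤ w x :=
  ciInf_le (f := fun w : {w // SuperClass d r ψ w} => w.1 x)
    ⟨ψ x, by rintro _ ⟨w, rfl⟩; exact w.2.le x⟩ ⟨w, hw⟩

lemma le_lowerEnv (h1 : ∀ x, ψ x ≤ 1) {x : EuclideanSpace ℝ (Fin d)} {a : ℝ}
    (h : ∀ w, SuperClass d r ψ w → a ≤ w x) : a ≤ lowerEnv d r ψ x :=
  haveI : Nonempty {w // SuperClass d r ψ w} := ⟨⟨_, superClass_one h1⟩⟩
  le_ciInf fun w => h w.1 w.2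

lemma obstacle_le_lowerEnv (h1 : ∀ x, ψ x ≤ 1) (x : EuclideanSpace ℝ (Fin d)) :
    ψ x ≤ lowerEnv d r ψ x :=
  le_lowerEnv h1 fun _ hw => hw.le x

lemma lowerEnv_le_one (h1 : ∀ x, ψ x ≤ 1) (x : EuclideanSpace ℝ (Fin d)) :
    lowerEnv d r ψ x ≤ 1 :=
  lowerEnv_le (superClass_one h1) x

lemma abs_lowerEnv_le (h0 : ∀ x, 0 ≤ ψ x) (h1 : ∀ x, ψ x ≤ 1) (x : EuclideanSpace ℝ (Fin d)) :
    |lowerEnv d r ψ x| ≤ 1 :=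
  abs_le.2 ⟨by linarith [h0 x, obstacle_le_lowerEnv (r := r) h1 x], lowerEnv_le_one h1 x⟩

lemma lowerEnv_le_add (h1 : ∀ x, ψ x ≤ 1) {h : EuclideanSpace ℝ (Fin d)} {e : ℝ}
    (he : ∀ y, ψ y ≤ ψ (y + h) + e) (z : EuclideanSpace ℝ (Fin d)) :
    lowerEnv d r ψ z ≤ lowerEnv d r ψ (z + h) + e := by
  rw [← sub_le_iff_le_add]
  refine le_lowerEnv h1 fun w hw => ?_
  rw [sub_le_iff_le_add]
  obtain ⟨B, hB⟩ := hw.bounded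
  refine lowerEnv_le (w := fun y => w (y + h) + e) ⟨(hw.measurable.comp (by fun_prop)).add_const e,
    ⟨B + |e|, fun x => (abs_add_le _ _).trans (add_le_add_left (hB _) _)⟩,
    fun x => (he x).trans (add_le_add_left (hw.le _) _), fun x => ?_⟩ z
  have hs := hw.super (x + h)
  have hi := integrable_kerAvg (r := r) one_pos hw.measurable hB (x + h)
  have : kerAvg d 1 r (fun y => w (y + h) + e) x = kerAvg d 1 r w (x + h) + kerMass d 1 * e := by
    rw [kerAvg, kerAvg, kerMass, mul_comm, ← integral_const_mul, ← integral_add hi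
      ((integrable_radialKer one_pos).const_mul e)]
    simp_rw [add_mul, add_right_comm x _ h]
  rw [this, mul_add]
  linarith

lemma uniformEquicontinuous_lowerEnv (h1 : ∀ x, ψ x ≤ 1) (hψ : UniformContinuous ψ)
    (r : ℕ → ℝ) : UniformEquicontinuous fun j => lowerEnv d (r j) ψ := by
  rw [Metric.uniformEquicontinuous_iff]
  intro ε hε
  obtain ⟨δ, hδ, h⟩ := Metric.uniformContinuous_iff.1 hψ (ε / 2) (by positivity)
  have key : ∀ x y : EuclideanSpace ℝ (Fin d), dist x y < δ → ∀ j,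
      lowerEnv d (r j) ψ x ≤ lowerEnv d (r j) ψ y + ε / 2 := by
    intro x y hxy j
    have := lowerEnv_le_add (r := r j) h1 (h := y - x) (e := ε / 2) (fun z => by
      have := h (a := z) (b := z + (y - x))
        (by rwa [dist_self_add_right, ← dist_eq_norm, dist_comm])
      rw [Real.dist_eq] at this
      linarith [(abs_lt.1 this).2]) x
    rwa [add_sub_cancel] at this
  refine ⟨δ, hδ, fun x y hxy j => ?_⟩
  rw [Real.dist_eq, abs_lt]
  have h2 := key x y hxy j
  have h3 := key y x (by rwa [dist_comm]) j
  constructor <;> linarith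

lemma continuous_lowerEnv (h1 : ∀ x, ψ x ≤ 1) (hψ : UniformContinuous ψ) :
    Continuous (lowerEnv d r ψ) :=
  ((uniformEquicontinuous_lowerEnv h1 hψ fun _ => r).uniformContinuous 0).continuous

lemma kerAvg_lowerEnv_le (h1 : ∀ x, ψ x ≤ 1) (hψ : UniformContinuous ψ)
    (hr : 0 < r) (x : EuclideanSpace ℝ (Fin d)) :
    kerAvg d 1 r (lowerEnv d r ψ) x ≤ kerMass d 1 * lowerEnv d r ψ x := by
  have hm := kerMass_pos (d := d) (c := 1) one_pos
  rw [← div_le_iff₀' hm]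
  refine le_lowerEnv h1 fun w hw => ?_
  rw [div_le_iff₀' hm]
  refine le_trans ?_ (hw.super x)
  obtain ⟨B, hB⟩ := hw.bounded
  exact kerAvg_mono one_pos hr (integrable_kerAvg_of_continuous one_pos
    (continuous_lowerEnv h1 hψ) r x) (integrable_kerAvg one_pos hw.measurable hB x)
    fun z _ => lowerEnv_le hw z

lemma kerAvg_lowerEnv_eq (h0 : ∀ x, 0 ≤ ψ x) (h1 : ∀ x, ψ x ≤ 1) (hψ : UniformContinuous ψ)
    (hr : 0 < r) {x : EuclideanSpace ℝ (Fin d)} (hx : ψ x < lowerEnv d r ψ x) :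
    kerAvg d 1 r (lowerEnv d r ψ) x = kerMass d 1 * lowerEnv d r ψ x := by
  have hm := kerMass_pos (d := d) (c := 1) one_pos
  refine le_antisymm (kerAvg_lowerEnv_le h1 hψ hr x) ?_
  rw [← le_div_iff₀' hm]
  have hVc := continuous_lowerEnv (r := r) h1 hψ
  have hKc : Continuous (kerAvg d 1 r (lowerEnv d r ψ)) :=
    (continuous_kerAvg one_pos hVc).comp (f := fun x => (r, x)) (by fun_prop)
  have hKle : ∀ y, kerAvg d 1 r (lowerEnv d r ψ) y / kerMass d 1 ≤ lowerEnv d r ψ y := fun y => by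
    rw [div_le_iff₀' hm]
    exact kerAvg_lowerEnv_le h1 hψ hr y
  set W := fun y => max (ψ y) (kerAvg d 1 r (lowerEnv d r ψ) y / kerMass d 1) with hW
  have hWc : Continuous W := hψ.continuous.max (hKc.div_const _)
  have hWle : ∀ y, W y ≤ lowerEnv d r ψ y := fun y =>
    max_le (obstacle_le_lowerEnv h1 y) (hKle y)
  have hSW : SuperClass d r ψ W := by
    refine ⟨hWc.measurable, ⟨1, fun y => abs_le.2 ⟨?_, (hWle y).trans (lowerEnv_le_one h1 y)⟩⟩,
      fun y => le_max_left _ _, fun y => ?_⟩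
    · linarith [h0 y, le_max_left (ψ y) (kerAvg d 1 r (lowerEnv d r ψ) y / kerMass d 1)]
    · refine (kerAvg_mono one_pos hr (integrable_kerAvg_of_continuous one_pos hWc r y)
        (integrable_kerAvg_of_continuous one_pos hVc r y) fun z _ => hWle z).trans ?_
      rw [← div_le_iff₀' hm]
      exact le_max_right _ _
  have h2 := lowerEnv_le hSW x
  rcases le_max_iff.1 h2 with h | h
  · exact absurd h (not_le.2 hx)
  · exact h

lemma kerAvg_comp_isometry (R : EuclideanSpace ℝ (Fin d) ≃ₗᵢ[ℝ] EuclideanSpace ℝ (Fin d))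
    (c : ℝ) (w : EuclideanSpace ℝ (Fin d) → ℝ) (x : EuclideanSpace ℝ (Fin d)) :
    kerAvg d c r (fun y => w (R y)) x = kerAvg d c r w (R x) := by
  rw [kerAvg, kerAvg, ← R.measurePreserving.integral_comp R.toMeasurableEquiv.measurableEmbedding
    fun y => w (R x + r • y) * radialKer d c y]
  simp [radialKer]

lemma lowerEnv_comp_isometry (h1 : ∀ x, ψ x ≤ 1)
    (R : EuclideanSpace ℝ (Fin d) ≃ₗᵢ[ℝ] EuclideanSpace ℝ (Fin d))
    (hR : ∀ x, ψ (R x) = ψ x) (hRR : ∀ x, R (R x) = x) (x : EuclideanSpace ℝ (Fin d)) :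
    lowerEnv d r ψ (R x) = lowerEnv d r ψ x := by
  have key : ∀ x, lowerEnv d r ψ x ≤ lowerEnv d r ψ (R x) := by
    intro x
    refine le_lowerEnv h1 fun w hw => ?_
    obtain ⟨B, hB⟩ := hw.bounded
    refine lowerEnv_le (w := fun y => w (R y)) ⟨hw.measurable.comp R.continuous.measurable,
      ⟨B, fun y => hB _⟩, fun y => ?_, fun y => ?_⟩ x
    · rw [← hR]
      exact hw.le _
    · rw [kerAvg_comp_isometry]
      exact hw.super _
  refine le_antisymm ?_ (key x)
  have := key (R x)
  rwa [hRR] at this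

end Envelope

section Compactness

lemma exists_subseq_tendsto_of_uniformEquicontinuous {X : Type*} [PseudoMetricSpace X]
    [TopologicalSpace.SeparableSpace X] [Nonempty X] {V : ℕ → X → ℝ} {B : ℝ}
    (hV : UniformEquicontinuous V) (hB : ∀ j x, |V j x| ≤ B) :
    ∃ φ : ℕ → ℕ, StrictMono φ ∧ ∃ V₀ : X → ℝ, ∀ x,
      Tendsto (fun j => V (φ j) x) atTop (𝓝 (V₀ x)) := by
  set D := TopologicalSpace.denseSeq X
  have hK : IsCompact (Set.pi univ fun _ : ℕ => Icc (-B) B) := isCompact_univ_pi fun _ =>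
    isCompact_Icc
  obtain ⟨a, -, φ, hφ, hlim⟩ := hK.tendsto_subseq (x := fun j k => V j (D k))
    fun j k _ => abs_le.1 (hB j _)
  rw [tendsto_pi_nhds] at hlim
  have hcau : ∀ x, ∃ l, Tendsto (fun j => V (φ j) x) atTop (𝓝 l) := by
    intro x
    refine cauchySeq_tendsto_of_complete (Metric.cauchySeq_iff.2 fun ε hε => ?_)
    obtain ⟨δ, hδ, h⟩ := Metric.uniformEquicontinuous_iff.1 hV (ε / 3) (by positivity)
    obtain ⟨k, hk⟩ := (TopologicalSpace.denseRange_denseSeq X).exists_mem_open isOpen_ball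
      ⟨x, mem_ball_self hδ⟩
    obtain ⟨N, hN⟩ := Metric.cauchySeq_iff.1 (hlim k).cauchySeq (ε / 3) (by positivity)
    refine ⟨N, fun i hi j hj => ?_⟩
    have h2 := h x (D k) (by rwa [dist_comm]) (φ i)
    have h3 := h (D k) x hk (φ j)
    have h4 := hN i hi j hj
    calc dist (V (φ i) x) (V (φ j) x)
        ≤ dist (V (φ i) x) (V (φ i) (D k)) + dist (V (φ i) (D k)) (V (φ j) (D k)) +
          dist (V (φ j) (D k)) (V (φ j) x) := dist_triangle4 _ _ _ _
      _ < ε / 3 + ε / 3 + ε / 3 := add_lt_add (add_lt_add h2 h4) h3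
      _ = ε := by ring
  choose V₀ hV₀ using hcau
  exact ⟨φ, hφ, V₀, hV₀⟩

end Compactness

theorem exists_obstacle_solution {d : ℕ} {ψ : EuclideanSpace ℝ (Fin d) → ℝ}
    (h0 : ∀ x, 0 ≤ ψ x) (h1 : ∀ x, ψ x ≤ 1) (hψ : UniformContinuous ψ) :
    ∃ V : EuclideanSpace ℝ (Fin d) → ℝ, Continuous V ∧ (∀ x, ψ x ≤ V x) ∧ (∀ x, V x ≤ 1) ∧
      (∀ c s x, 0 < c → 0 ≤ s → kerAvg d c s V x ≤ kerMass d c * V x) ∧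
      (∀ x, ψ x < V x → ContDiffAt ℝ 2 V x ∧ lapl d V x = 0) ∧
      (∀ R : EuclideanSpace ℝ (Fin d) ≃ₗᵢ[ℝ] EuclideanSpace ℝ (Fin d), (∀ x, ψ (R x) = ψ x) →
        (∀ x, R (R x) = x) → ∀ x, V (R x) = V x) ∧
      ∀ x, (∃ a > 0, ∀ r, 0 < r → r < a → ∃ w, SuperClass d r ψ w ∧ w x ≤ ψ x) → V x = ψ x := by
  have hV := uniformEquicontinuous_lowerEnv h1 hψ (d := d) fun j : ℕ => 1 / ((j : ℝ) + 1)
  obtain ⟨φ, hφ, V₀, hlim⟩ := exists_subseq_tendsto_of_uniformEquicontinuous hV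
    fun j x => abs_lowerEnv_le h0 h1 x
  set r : ℕ → ℝ := fun j => 1 / ((φ j : ℝ) + 1) with hr
  set V : ℕ → EuclideanSpace ℝ (Fin d) → ℝ := fun j => lowerEnv d (r j) ψ with hVdef
  have hrpos : ∀ j, 0 < r j := fun j => by positivity
  have hr0 : Tendsto r atTop (𝓝 0) :=
    (tendsto_one_div_add_atTop_nhds_zero_nat (𝕜 := ℝ)).comp hφ.tendsto_atTop
  have hVe : UniformEquicontinuous V := uniformEquicontinuous_lowerEnv h1 hψ r
  have hlim' : ∀ x, Tendsto (fun j => V j x) atTop (𝓝 (V₀ x)) := hlim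
  have hB : ∀ j x, |V j x| ≤ 1 := fun j x => abs_lowerEnv_le h0 h1 x
  have hVc : Continuous V₀ :=
    (tendsto_pi_nhds.2 hlim').continuous_of_equicontinuous hVe.equicontinuous
  refine ⟨V₀, hVc, fun x => ?_, fun x => ?_, fun c s x hc hs => ?_, fun x hx => ?_,
    fun R hR hRR x => ?_, fun x hx => ?_⟩
  · exact ge_of_tendsto' (hlim' x) fun j => obstacle_le_lowerEnv h1 x
  · exact le_of_tendsto' (hlim' x) fun j => lowerEnv_le_one h1 x
  · refine kerAvg_le_of_mollified hVc hc hs one_pos fun ε hε _ z _ => ?_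
    exact lapl_convR_nonpos one_pos hB hVe hlim' hVc hrpos hr0 (contDiff_scaledKer ε)
      (hasCompactSupport_scaledKer hε) (scaledKer_nonneg ε) (a := ε)
      (fun y hy => scaledKer_eq_zero hε hy)
      (Eventually.of_forall fun j t _ => kerAvg_lowerEnv_le h1 hψ (hrpos j) t)
  · set η := (V₀ x - ψ x) / 3 with hη
    have hη0 : 0 < η := by rw [hη]; linarith
    obtain ⟨ρ₁, hρ₁, hb₁⟩ := Metric.uniformEquicontinuous_iff.1 hVe η hη0
    obtain ⟨ρ₂, hρ₂, hb₂⟩ := Metric.uniformContinuous_iff.1 hψ η hη0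
    set ρ := min ρ₁ ρ₂ with hρ
    have hρ0 : 0 < ρ := lt_min hρ₁ hρ₂
    have hev : ∀ᶠ j in atTop, ∀ y ∈ ball x ρ,
        kerAvg d 1 (r j) (V j) y = kerMass d 1 * V j y := by
      filter_upwards [(hlim' x).eventually (lt_mem_nhds (sub_lt_self (V₀ x) hη0))] with j hj y hy
      refine kerAvg_lowerEnv_eq h0 h1 hψ (hrpos j) ?_
      have h2 := abs_lt.1 (hb₁ y x (lt_of_lt_of_le hy (min_le_left _ _)) j)
      have h3 := abs_lt.1 (hb₂ (a := y) (b := x) (lt_of_lt_of_le hy (min_le_right _ _)))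
      have h4 : V j y = lowerEnv d (r j) ψ y := rfl
      have h5 : V j y - V j x = lowerEnv d (r j) ψ y - lowerEnv d (r j) ψ x := rfl
      linarith [h2.1, h3.2]
    refine harmonic_of_kerAvg_eq hVc (a := ρ / 3) (by positivity) fun y hy s hs hsa => ?_
    have hsub : ∀ ε, ε < ρ / 3 → ∀ z ∈ closedBall y s, ball z ε ⊆ ball x ρ := by
      intro ε hε z hz t ht
      rw [mem_ball] at *
      rw [mem_closedBall] at hz
      linarith [dist_triangle t z x, dist_triangle z y x]
    refine le_antisymm (kerAvg_le_of_mollified hVc one_pos hs.le (a := ρ / 3) (by positivity)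
      fun ε hε hεa z hz => ?_) ?_
    · exact lapl_convR_nonpos one_pos hB hVe hlim' hVc hrpos hr0 (contDiff_scaledKer ε)
        (hasCompactSupport_scaledKer hε) (scaledKer_nonneg ε) (a := ε)
        (fun y hy => scaledKer_eq_zero hε hy)
        (Eventually.of_forall fun j t _ => kerAvg_lowerEnv_le h1 hψ (hrpos j) t)
    · have := kerAvg_le_of_mollified hVc.neg one_pos hs.le (a := ρ / 3) (x := y) (by positivity)
        fun ε hε hεa z hz => by
          refine lapl_convR_nonpos (V := fun j y => -V j y) one_pos
            (fun j x => (abs_neg (V j x)).le.trans (hB j x)) ?_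
            (fun x => (hlim' x).neg) hVc.neg hrpos hr0 (contDiff_scaledKer ε)
            (hasCompactSupport_scaledKer hε) (scaledKer_nonneg ε) (a := ε)
            (fun y hy => scaledKer_eq_zero hε hy) ?_
          · rw [Metric.uniformEquicontinuous_iff] at hVe ⊢
            simpa only [dist_neg_neg] using hVe
          · filter_upwards [hev] with j hj t ht
            rw [kerAvg_neg, hj t (hsub ε hεa z hz ht)]
            linarith
      rw [show (-V₀) = fun y => -V₀ y from rfl, kerAvg_neg] at this
      simp only at this
      linarith
  · refine tendsto_nhds_unique (hlim' (R x)) ((hlim' x).congr fun j => ?_)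
    exact (lowerEnv_comp_isometry h1 R hR hRR x).symm
  · obtain ⟨a, ha, hw⟩ := hx
    refine le_antisymm (le_of_tendsto (hlim' x) ?_)
      (ge_of_tendsto' (hlim' x) fun j => obstacle_le_lowerEnv h1 x)
    filter_upwards [hr0.eventually (gt_mem_nhds ha)] with j hj
    obtain ⟨w, hw1, hw2⟩ := hw (r j) (hrpos j) hj
    exact (lowerEnv_le hw1 x).trans hw2

section Barriers

variable {d : ℕ}

lemma exists_taylor_bound {g : EuclideanSpace ℝ (Fin d) → ℝ} (hg : ContDiff ℝ 2 g) (R : ℝ) :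
    ∃ C, 0 ≤ C ∧ ∀ x, ‖x‖ ≤ R → ∃ L : EuclideanSpace ℝ (Fin d) →L[ℝ] ℝ,
      ∀ y, ‖y‖ ≤ 1 → |L y| ≤ C ∧ |g (x + y) - g x - L y| ≤ C * ‖y‖ ^ 2 := by
  have hg1 : ContDiff ℝ 1 (fderiv ℝ g) := hg.fderiv_right (by norm_num)
  obtain ⟨C₁, hC₁⟩ := (isCompact_closedBall (0 : EuclideanSpace ℝ (Fin d)) (R + 1)).exists_bound_of_continuousOn
    (hg1.continuous.continuousOn)
  obtain ⟨C₂, hC₂⟩ := (isCompact_closedBall (0 : EuclideanSpace ℝ (Fin d)) (R + 1)).exists_bound_of_continuousOn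
    ((hg1.continuous_fderiv one_ne_zero).continuousOn)
  refine ⟨max (max C₁ C₂) 0, le_max_right _ _, fun x hx => ⟨fderiv ℝ g x, fun y hy => ⟨?_, ?_⟩⟩⟩
  · have h1 := hC₁ x (by simp; linarith)
    calc |fderiv ℝ g x y| ≤ ‖fderiv ℝ g x‖ * ‖y‖ := (fderiv ℝ g x).le_opNorm y
      _ ≤ ‖fderiv ℝ g x‖ * 1 := by gcongr
      _ ≤ _ := by rw [mul_one]; exact h1.trans ((le_max_left _ _).trans (le_max_left _ _))
  · set C := max (max C₁ C₂) 0
    have hsub : closedBall x ‖y‖ ⊆ closedBall 0 (R + 1) := by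
      intro z hz
      rw [mem_closedBall, dist_eq_norm] at hz
      rw [mem_closedBall_zero_iff]
      linarith [norm_le_norm_add_norm_sub' z x]
    have hL : ∀ z ∈ closedBall x ‖y‖, ‖fderiv ℝ g z - fderiv ℝ g x‖ ≤ C * ‖y‖ := by
      intro z hz
      have := (convex_closedBall x ‖y‖).norm_image_sub_le_of_norm_fderiv_le (𝕜 := ℝ)
        (f := fderiv ℝ g) (C := C)
        (fun w _ => (hg1.differentiable one_ne_zero).differentiableAt)
        (fun w hw => (hC₂ w (hsub hw)).trans ((le_max_right _ _).trans (le_max_left _ _)))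
        (mem_closedBall_self (norm_nonneg y)) hz
      refine this.trans (mul_le_mul_of_nonneg_left ?_ (le_max_right _ _))
      rwa [mem_closedBall, dist_eq_norm] at hz
    have := (convex_closedBall x ‖y‖).norm_image_sub_le_of_norm_fderiv_le' (𝕜 := ℝ)
      (f := g) (φ := fderiv ℝ g x) (y := x + y)
      (fun w _ => (hg.differentiable two_ne_zero).differentiableAt) hL
      (mem_closedBall_self (norm_nonneg y)) (by simp)
    simpa [pow_two, mul_assoc] using this

lemma hasFDerivAt_quadratic (c : ℝ) (L : EuclideanSpace ℝ (Fin d) →L[ℝ] ℝ) (b : Fin d → ℝ)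
    (x z : EuclideanSpace ℝ (Fin d)) :
    HasFDerivAt (fun z : EuclideanSpace ℝ (Fin d) => c + L (z - x) + ∑ i, b i * (z i - x i) ^ 2)
      (L + ∑ i, (b i * (2 * (z i - x i))) • EuclideanSpace.proj (𝕜 := ℝ) i) z := by
  refine ((L.hasFDerivAt.comp z ((hasFDerivAt_id z).sub_const x)).const_add c).add
    (HasFDerivAt.fun_sum fun i _ => ?_)
  have h1 : HasFDerivAt (fun z : EuclideanSpace ℝ (Fin d) => z i - x i)
      (EuclideanSpace.proj (𝕜 := ℝ) i : EuclideanSpace ℝ (Fin d) →L[ℝ] ℝ) z :=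
    (EuclideanSpace.proj (𝕜 := ℝ) i : EuclideanSpace ℝ (Fin d) →L[ℝ] ℝ).hasFDerivAt.sub_const _
  convert! (h1.pow 2).const_mul (b i) using 1
  ext v
  simp
  ring

lemma contDiff_quadratic (c : ℝ) (L : EuclideanSpace ℝ (Fin d) →L[ℝ] ℝ) (b : Fin d → ℝ)
    (x : EuclideanSpace ℝ (Fin d)) :
    ContDiff ℝ 2 fun z : EuclideanSpace ℝ (Fin d) => c + L (z - x) + ∑ i, b i * (z i - x i) ^ 2 := by
  have := L.contDiff (n := 2)
  fun_prop

lemma lapl_quadratic (c : ℝ) (L : EuclideanSpace ℝ (Fin d) →L[ℝ] ℝ) (b : Fin d → ℝ)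
    (x z : EuclideanSpace ℝ (Fin d)) :
    lapl d (fun z => c + L (z - x) + ∑ i, b i * (z i - x i) ^ 2) z = 2 * ∑ i, b i := by
  have h1 : ∀ i : Fin d, (fun y => fderiv ℝ (fun z : EuclideanSpace ℝ (Fin d) =>
      c + L (z - x) + ∑ i, b i * (z i - x i) ^ 2) y (EuclideanSpace.single i 1)) =
      fun y => L (EuclideanSpace.single i 1) + b i * (2 * (y i - x i)) := by
    intro i
    ext y
    rw [(hasFDerivAt_quadratic c L b x y).fderiv]
    simp [PiLp.single_apply]
  rw [lapl, Finset.mul_sum]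
  refine Finset.sum_congr rfl fun i _ => ?_
  rw [h1]
  have h2 : HasFDerivAt (fun y : EuclideanSpace ℝ (Fin d) =>
      L (EuclideanSpace.single i 1) + b i * (2 * (y i - x i)))
      (b i • (2 : ℝ) • EuclideanSpace.proj (𝕜 := ℝ) i : EuclideanSpace ℝ (Fin d) →L[ℝ] ℝ) z :=
    ((((EuclideanSpace.proj (𝕜 := ℝ) i : EuclideanSpace ℝ (Fin d) →L[ℝ] ℝ).hasFDerivAt.sub_const
      _).const_mul 2).const_mul (b i)).const_add _
  rw [h2.fderiv]
  simp
  ring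

/-- A smooth positive superharmonic function of dimension at least three decaying at infinity. -/
def decayBarrier (d : ℕ) (z : EuclideanSpace ℝ (Fin d)) : ℝ := (1 + ‖z‖ ^ 2) ^ (-(1 : ℝ) / 2)

lemma contDiff_one_add_norm_sq_rpow (p : ℝ) :
    ContDiff ℝ 2 fun z : EuclideanSpace ℝ (Fin d) => (1 + ‖z‖ ^ 2) ^ p :=
  (contDiff_const.add (contDiff_norm_sq ℝ)).rpow_const_of_ne fun z => by positivity

lemma hasFDerivAt_one_add_norm_sq_rpow (p : ℝ) (z : EuclideanSpace ℝ (Fin d)) :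
    HasFDerivAt (fun z : EuclideanSpace ℝ (Fin d) => (1 + ‖z‖ ^ 2) ^ p)
      ((2 * p * (1 + ‖z‖ ^ 2) ^ (p - 1)) • innerSL ℝ z) z := by
  have h1 : HasFDerivAt (fun y : EuclideanSpace ℝ (Fin d) => 1 + ‖y‖ ^ 2) (2 • innerSL ℝ z) z :=
    (hasStrictFDerivAt_norm_sq z).hasFDerivAt.const_add 1
  convert! h1.rpow_const (p := p) (Or.inl (by positivity)) using 1
  ext v
  simp
  ring

lemma lapl_decayBarrier_nonpos (hd : 3 ≤ d) (z : EuclideanSpace ℝ (Fin d)) :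
    lapl d (decayBarrier d) z ≤ 0 := by
  have h1 : ∀ i : Fin d, (fun y => fderiv ℝ (decayBarrier d) y (EuclideanSpace.single i 1)) =
      fun y => -((1 + ‖y‖ ^ 2) ^ (-(3 : ℝ) / 2) * y i) := by
    intro i
    ext y
    unfold decayBarrier
    rw [(hasFDerivAt_one_add_norm_sq_rpow _ y).fderiv]
    simp [EuclideanSpace.inner_single_right]
    norm_num
  have hpos : 0 < 1 + ‖z‖ ^ 2 := by positivity
  set P := (1 + ‖z‖ ^ 2) ^ (-(5 : ℝ) / 2) with hP
  have hP0 : 0 < P := by positivity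
  have h3 : (1 + ‖z‖ ^ 2) ^ (-(3 : ℝ) / 2) = (1 + ‖z‖ ^ 2) * P := by
    rw [hP, ← Real.rpow_one_add' hpos.le (by norm_num)]
    norm_num
  have h2 : ∀ i : Fin d, fderiv ℝ (fun y : EuclideanSpace ℝ (Fin d) =>
      -((1 + ‖y‖ ^ 2) ^ (-(3 : ℝ) / 2) * y i)) z (EuclideanSpace.single i 1) =
      P * (3 * z i ^ 2 - (1 + ‖z‖ ^ 2)) := by
    intro i
    have := ((hasFDerivAt_one_add_norm_sq_rpow (-(3 : ℝ) / 2) z).mul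
      (EuclideanSpace.proj (𝕜 := ℝ) i : EuclideanSpace ℝ (Fin d) →L[ℝ] ℝ).hasFDerivAt).neg
    have e : (fun y : EuclideanSpace ℝ (Fin d) => -((1 + ‖y‖ ^ 2) ^ (-(3 : ℝ) / 2) * y i)) =
      -((fun y : EuclideanSpace ℝ (Fin d) => (1 + ‖y‖ ^ 2) ^ (-(3 : ℝ) / 2)) *
        ⇑(EuclideanSpace.proj (𝕜 := ℝ) i : EuclideanSpace ℝ (Fin d) →L[ℝ] ℝ)) := rfl
    rw [e, this.fderiv]
    have e2 : (-(3 : ℝ) / 2 - 1) = -(5 : ℝ) / 2 := by norm_num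
    simp [EuclideanSpace.inner_single_right, h3, e2, ← hP]
    ring
  simp_rw [lapl, h1, h2, ← Finset.mul_sum, Finset.sum_sub_distrib, ← Finset.mul_sum]
  have h4 : ∑ i, z i ^ 2 = ‖z‖ ^ 2 := by
    rw [EuclideanSpace.norm_sq_eq]
    simp
  rw [h4]
  have hd' : (3 : ℝ) ≤ d := by exact_mod_cast hd
  simp only [Finset.sum_const, Finset.card_univ, Fintype.card_fin, nsmul_eq_mul]
  refine mul_nonpos_of_nonneg_of_nonpos hP0.le ?_
  nlinarith [sq_nonneg ‖z‖]

lemma decayBarrier_pos (z : EuclideanSpace ℝ (Fin d)) : 0 < decayBarrier d z := by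
  unfold decayBarrier
  positivity

lemma decayBarrier_eq (z : EuclideanSpace ℝ (Fin d)) :
    decayBarrier d z = (√(1 + ‖z‖ ^ 2))⁻¹ := by
  rw [decayBarrier, Real.sqrt_eq_rpow, ← Real.rpow_neg (by positivity)]
  norm_num

lemma decayBarrier_le_one (z : EuclideanSpace ℝ (Fin d)) : decayBarrier d z ≤ 1 := by
  rw [decayBarrier_eq]
  refine inv_le_one_of_one_le₀ (Real.one_le_sqrt.2 ?_)
  linarith [sq_nonneg ‖z‖]

lemma one_le_mul_decayBarrier {A : ℝ} (hA : 0 ≤ A) {z : EuclideanSpace ℝ (Fin d)}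
    (hz : 1 + ‖z‖ ^ 2 ≤ A ^ 2) : 1 ≤ A * decayBarrier d z := by
  have hpos : 0 < √(1 + ‖z‖ ^ 2) := Real.sqrt_pos.2 (by positivity)
  rw [decayBarrier_eq, ← div_eq_mul_inv, one_le_div hpos]
  exact Real.sqrt_le_iff.2 ⟨hA, hz⟩

lemma mul_decayBarrier_le {A : ℝ} {z : EuclideanSpace ℝ (Fin d)}
    (hz : 2 * A ≤ ‖z‖) : A * decayBarrier d z ≤ 1 / 2 := by
  have hpos : 0 < √(1 + ‖z‖ ^ 2) := Real.sqrt_pos.2 (by positivity)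
  rw [decayBarrier_eq, ← div_eq_mul_inv, div_le_iff₀ hpos]
  have : ‖z‖ ≤ √(1 + ‖z‖ ^ 2) := Real.le_sqrt_of_sq_le (by linarith)
  linarith

open Classical in
lemma superClass_glue {r ρ ρ' : ℝ} {ψ a b : EuclideanSpace ℝ (Fin d) → ℝ}
    {x₀ : EuclideanSpace ℝ (Fin d)} (hr : 0 < r) (hrρ : r ≤ ρ - ρ') (hψ : ∀ x, 0 ≤ ψ x)
    (ha : SuperClass d r ψ a) (hb : Continuous b)
    (hbψ : ∀ z ∈ ball x₀ ρ, ψ z ≤ b z)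
    (hbs : ∀ z ∈ ball x₀ ρ, kerAvg d 1 r b z ≤ kerMass d 1 * b z)
    (hab : ∀ z ∈ ball x₀ ρ, ρ' ≤ dist z x₀ → a z ≤ b z) :
    SuperClass d r ψ fun z => if z ∈ ball x₀ ρ then min (a z) (b z) else a z := by
  set W := fun z => if z ∈ ball x₀ ρ then min (a z) (b z) else a z with hW
  obtain ⟨B, hB⟩ := ha.bounded
  have hWa : ∀ z, W z ≤ a z := by
    intro z
    simp only [hW]
    split_ifs
    exacts [min_le_left _ _, le_rfl]
  have hWb : ∀ z ∈ ball x₀ ρ, W z ≤ b z := by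
    intro z hz
    simp only [hW, if_pos hz]
    exact min_le_right _ _
  have hψW : ∀ z, ψ z ≤ W z := by
    intro z
    simp only [hW]
    split_ifs with h
    exacts [le_min (ha.le z) (hbψ z h), ha.le z]
  have hWm : Measurable W := Measurable.ite measurableSet_ball
    (ha.measurable.min hb.measurable) ha.measurable
  have hWB : ∀ z, |W z| ≤ B := fun z =>
    (abs_of_nonneg ((hψ z).trans (hψW z))).le.trans ((hWa z).trans ((le_abs_self _).trans (hB z)))
  refine ⟨hWm, ⟨B, hWB⟩, hψW, fun x => ?_⟩
  have hWi := integrable_kerAvg (d := d) (r := r) one_pos hWm hWB x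
  rcases eq_or_ne (W x) (a x) with h | h
  · rw [h]
    exact (kerAvg_mono one_pos hr hWi (integrable_kerAvg one_pos ha.measurable hB x)
      fun z _ => hWa z).trans (ha.super x)
  · have hx : x ∈ ball x₀ ρ := by
      by_contra hx
      exact h (if_neg hx)
    have hWx : W x = min (a x) (b x) := if_pos hx
    have hba : b x < a x := by
      by_contra! hab'
      exact h (hWx.trans (min_eq_left hab'))
    have hdist : dist x x₀ < ρ' := by
      by_contra! hd
      exact absurd (hab x hx hd) (not_le.2 hba)
    rw [hWx, min_eq_right hba.le]
    refine (kerAvg_mono one_pos hr hWi (integrable_kerAvg_of_continuous one_pos hb r x)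
      fun z hz => hWb z ?_).trans (hbs x hx)
    rw [mem_ball] at *
    linarith [dist_triangle z x x₀]

end Barriers

section ThinCoordinates

variable {n : ℕ}

/-- `thinProj` as a continuous linear map. -/
def thinProjL (n : ℕ) : EuclideanSpace ℝ (Fin (n + 1)) →L[ℝ] EuclideanSpace ℝ (Fin n) :=
  ((EuclideanSpace.equiv (Fin n) ℝ).symm : (Fin n → ℝ) →L[ℝ] EuclideanSpace ℝ (Fin n)).comp
    (ContinuousLinearMap.pi fun i : Fin n => EuclideanSpace.proj (𝕜 := ℝ) i.castSucc)

lemma thinProjL_apply (z : EuclideanSpace ℝ (Fin (n + 1))) : thinProjL n z = thinProj n z := rfl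

@[simp]
lemma thinProj_apply (z : EuclideanSpace ℝ (Fin (n + 1))) (i : Fin n) :
    thinProj n z i = z i.castSucc := rfl

lemma thinProj_sub (z w : EuclideanSpace ℝ (Fin (n + 1))) :
    thinProj n (z - w) = thinProj n z - thinProj n w := map_sub (thinProjL n) z w

lemma continuous_thinProj : Continuous (thinProj n) := (thinProjL n).continuous

@[simp]
lemma thinEmbed_last (x' : EuclideanSpace ℝ (Fin n)) (t : ℝ) :
    thinEmbed n x' t (Fin.last n) = t := by
  simp [thinEmbed]

@[simp]
lemma thinEmbed_castSucc (x' : EuclideanSpace ℝ (Fin n)) (t : ℝ) (i : Fin n) :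
    thinEmbed n x' t i.castSucc = x' i := by
  simp [thinEmbed]

@[simp]
lemma thinProj_thinEmbed (x' : EuclideanSpace ℝ (Fin n)) (t : ℝ) :
    thinProj n (thinEmbed n x' t) = x' := by
  ext i
  simp

lemma thinEmbed_thinProj (z : EuclideanSpace ℝ (Fin (n + 1))) :
    thinEmbed n (thinProj n z) (z (Fin.last n)) = z := by
  ext i
  refine Fin.lastCases ?_ (fun i => ?_) i <;> simp

lemma norm_sq_eq_thinProj (z : EuclideanSpace ℝ (Fin (n + 1))) :
    ‖z‖ ^ 2 = ‖thinProj n z‖ ^ 2 + z (Fin.last n) ^ 2 := by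
  rw [EuclideanSpace.norm_sq_eq, EuclideanSpace.norm_sq_eq, Fin.sum_univ_castSucc]
  simp

lemma norm_thinProj_le (z : EuclideanSpace ℝ (Fin (n + 1))) : ‖thinProj n z‖ ≤ ‖z‖ := by
  refine le_of_sq_le_sq ?_ (norm_nonneg z)
  rw [norm_sq_eq_thinProj z]
  linarith [sq_nonneg (z (Fin.last n))]

lemma abs_last_le_norm (z : EuclideanSpace ℝ (Fin (n + 1))) : |z (Fin.last n)| ≤ ‖z‖ := by
  simpa using PiLp.norm_apply_le z (Fin.last n)

/-- Reflection across the thin space. -/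
def flipLast (n : ℕ) : EuclideanSpace ℝ (Fin (n + 1)) ≃ₗᵢ[ℝ] EuclideanSpace ℝ (Fin (n + 1)) :=
  LinearIsometryEquiv.piLpCongrRight 2 fun i =>
    if i = Fin.last n then LinearIsometryEquiv.neg ℝ else LinearIsometryEquiv.refl ℝ ℝ

@[simp]
lemma flipLast_last (z : EuclideanSpace ℝ (Fin (n + 1))) :
    flipLast n z (Fin.last n) = -z (Fin.last n) := by
  simp [flipLast]

@[simp]
lemma flipLast_castSucc (z : EuclideanSpace ℝ (Fin (n + 1))) (i : Fin n) :
    flipLast n z i.castSucc = z i.castSucc := by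
  simp [flipLast, (Fin.castSucc_lt_last i).ne]

@[simp]
lemma thinProj_flipLast (z : EuclideanSpace ℝ (Fin (n + 1))) :
    thinProj n (flipLast n z) = thinProj n z := by
  ext i
  simp

lemma flipLast_flipLast (z : EuclideanSpace ℝ (Fin (n + 1))) : flipLast n (flipLast n z) = z := by
  ext i
  refine Fin.lastCases ?_ (fun i => ?_) i <;> simp

lemma flipLast_thinEmbed (x' : EuclideanSpace ℝ (Fin n)) (t : ℝ) :
    flipLast n (thinEmbed n x' t) = thinEmbed n x' (-t) := by
  ext i
  refine Fin.lastCases ?_ (fun i => ?_) i <;> simp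

/-- Quadratic functions that are isotropic in the thin directions. -/
def thinQuad (n : ℕ) (c : ℝ) (L : EuclideanSpace ℝ (Fin (n + 1)) →L[ℝ] ℝ) (α β : ℝ)
    (x z : EuclideanSpace ℝ (Fin (n + 1))) : ℝ :=
  c + L (z - x) + (α * ‖thinProj n z - thinProj n x‖ ^ 2 +
    β * (z (Fin.last n) - x (Fin.last n)) ^ 2)

lemma thinQuad_eq (c : ℝ) (L : EuclideanSpace ℝ (Fin (n + 1)) →L[ℝ] ℝ) (α β : ℝ)
    (x : EuclideanSpace ℝ (Fin (n + 1))) :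
    thinQuad n c L α β x = fun z => c + L (z - x) +
      ∑ i, (Fin.snoc (fun _ => α) β : Fin (n + 1) → ℝ) i * (z i - x i) ^ 2 := by
  ext z
  rw [thinQuad, Fin.sum_univ_castSucc, EuclideanSpace.norm_sq_eq, Finset.mul_sum]
  simp

lemma contDiff_thinQuad (c : ℝ) (L : EuclideanSpace ℝ (Fin (n + 1)) →L[ℝ] ℝ) (α β : ℝ)
    (x : EuclideanSpace ℝ (Fin (n + 1))) : ContDiff ℝ 2 (thinQuad n c L α β x) := by
  rw [thinQuad_eq]
  exact contDiff_quadratic _ _ _ _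

lemma lapl_thinQuad (c : ℝ) (L : EuclideanSpace ℝ (Fin (n + 1)) →L[ℝ] ℝ) (α β : ℝ)
    (x z : EuclideanSpace ℝ (Fin (n + 1))) :
    lapl (n + 1) (thinQuad n c L α β x) z = 2 * (n * α + β) := by
  rw [thinQuad_eq, lapl_quadratic, Fin.sum_univ_castSucc]
  simp

end ThinCoordinates

section Obstacle

variable {n : ℕ}

/-- The full obstacle before truncation. -/
def rawObst (n : ℕ) (s : EuclideanSpace ℝ (Fin n) → ℝ) (k : ℕ) (K : ℝ)
    (z : EuclideanSpace ℝ (Fin (n + 1))) : ℝ :=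
  1 - s (thinProj n z) ^ (k + 1) + K * (max (1 - |z (Fin.last n)|) 0 ^ 2 - 1)

/-- The truncated obstacle. -/
def thinObst (n : ℕ) (s : EuclideanSpace ℝ (Fin n) → ℝ) (k : ℕ) (K : ℝ)
    (z : EuclideanSpace ℝ (Fin (n + 1))) : ℝ :=
  max (rawObst n s k K z) 0

variable {s : EuclideanSpace ℝ (Fin n) → ℝ} {k : ℕ} {K : ℝ}

lemma thinObst_nonneg (z : EuclideanSpace ℝ (Fin (n + 1))) : 0 ≤ thinObst n s k K z :=
  le_max_right _ _

lemma profile_le_one_sub (t : ℝ) : max (1 - |t|) 0 ^ 2 ≤ max (1 - |t|) 0 := by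
  have h1 : 0 ≤ max (1 - |t|) 0 := le_max_right _ _
  have h2 : max (1 - |t|) 0 ≤ 1 := max_le (by linarith [abs_nonneg t]) zero_le_one
  nlinarith

lemma thinObst_le (hK : 1 ≤ K) (hs : ∀ x, 1 / 2 ≤ s x) (z : EuclideanSpace ℝ (Fin (n + 1))) :
    thinObst n s k K z ≤ max (1 - |z (Fin.last n)|) 0 := by
  refine max_le ?_ (le_max_right _ _)
  have h1 := profile_le_one_sub (z (Fin.last n))
  have h2 : max (1 - |z (Fin.last n)|) 0 ≤ 1 :=
    max_le (by linarith [abs_nonneg (z (Fin.last n))]) zero_le_one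
  have h3 : 0 ≤ s (thinProj n z) ^ (k + 1) := pow_nonneg (by linarith [hs (thinProj n z)]) _
  unfold rawObst
  nlinarith

lemma thinObst_le_one (hK : 1 ≤ K) (hs : ∀ x, 1 / 2 ≤ s x) (z : EuclideanSpace ℝ (Fin (n + 1))) :
    thinObst n s k K z ≤ 1 :=
  (thinObst_le hK hs z).trans (max_le (by linarith [abs_nonneg (z (Fin.last n))]) zero_le_one)

lemma abs_last_lt_of_thinObst_pos (hK : 1 ≤ K) (hs : ∀ x, 1 / 2 ≤ s x)
    {z : EuclideanSpace ℝ (Fin (n + 1))} (hz : 0 < thinObst n s k K z) :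
    |z (Fin.last n)| < 1 := by
  have := hz.trans_le (thinObst_le hK hs z)
  rcases lt_max_iff.1 this with h | h
  · linarith
  · exact absurd h (lt_irrefl _)

lemma lt_one_of_thinObst_pos (hK : 1 ≤ K) {z : EuclideanSpace ℝ (Fin (n + 1))}
    (hz : 0 < thinObst n s k K z) : s (thinProj n z) < 1 := by
  by_contra! h
  have h1 : 1 ≤ s (thinProj n z) ^ (k + 1) := one_le_pow₀ h
  have h2 := profile_le_one_sub (z (Fin.last n))
  have h3 : max (1 - |z (Fin.last n)|) 0 ≤ 1 :=
    max_le (by linarith [abs_nonneg (z (Fin.last n))]) zero_le_one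
  rcases lt_max_iff.1 hz with h | h
  · unfold rawObst at h
    nlinarith
  · exact lt_irrefl _ h

lemma continuous_thinObst (hs : Continuous s) : Continuous (thinObst n s k K) := by
  have := continuous_thinProj (n := n)
  unfold thinObst rawObst
  fun_prop

lemma norm_sq_le_of_thinObst_pos (hK : 1 ≤ K) (hs : ∀ x, 1 / 2 ≤ s x) {R : ℝ}
    (hR : ∀ x, s x < 1 → ‖x‖ ≤ R) {z : EuclideanSpace ℝ (Fin (n + 1))}
    (hz : 0 < thinObst n s k K z) : ‖z‖ ^ 2 ≤ R ^ 2 + 1 := by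
  have h1 := hR _ (lt_one_of_thinObst_pos hK hz)
  have h2 := abs_last_lt_of_thinObst_pos hK hs hz
  rw [norm_sq_eq_thinProj, ← sq_abs (z (Fin.last n))]
  nlinarith [norm_nonneg (thinProj n z), abs_nonneg (z (Fin.last n))]

lemma uniformContinuous_thinObst (hs : Continuous s) (hK : 1 ≤ K) (hs' : ∀ x, 1 / 2 ≤ s x) {R : ℝ}
    (hR : ∀ x, s x < 1 → ‖x‖ ≤ R) : UniformContinuous (thinObst n s k K) := by
  refine HasCompactSupport.uniformContinuous_of_continuous ?_ (continuous_thinObst hs)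
  refine HasCompactSupport.intro (isCompact_closedBall 0 (√(R ^ 2 + 1))) fun z hz => ?_
  by_contra hne
  refine hz ?_
  rw [mem_closedBall_zero_iff]
  exact Real.le_sqrt_of_sq_le (norm_sq_le_of_thinObst_pos hK hs' hR
    (lt_of_le_of_ne (thinObst_nonneg z) (Ne.symm hne)))

lemma thinObst_flipLast (z : EuclideanSpace ℝ (Fin (n + 1))) :
    thinObst n s k K (flipLast n z) = thinObst n s k K z := by
  simp [thinObst, rawObst]

lemma rawObst_thinEmbed_zero (x' : EuclideanSpace ℝ (Fin n)) :
    rawObst n s k K (thinEmbed n x' 0) = 1 - s x' ^ (k + 1) := by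
  simp [rawObst]

lemma exists_superClass_tent (hn : 2 ≤ n) (hK : 1 ≤ K) (hs : ∀ x, 1 / 2 ≤ s x) {R : ℝ}
    (hR0 : 0 ≤ R) (hR : ∀ x, s x < 1 → ‖x‖ ≤ R) {c : ℝ} (hc : c = 1 / (2 * (2 * (R + 3) + 1)))
    {r : ℝ} (hr : 0 < r) (hr1 : r < 1) :
    ∃ w, SuperClass (n + 1) r (thinObst n s k K) w ∧
      ∀ z, ‖z‖ < R + 1 → w z ≤ 1 - c * |z (Fin.last n)| := by
  set A := R + 3 with hA
  have hA3 : 3 ≤ A := by linarith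
  have hc0 : 0 < c := by rw [hc]; positivity
  have hcR : c * (2 * A + 1) = 1 / 2 := by rw [hc]; field_simp
  have hc1 : c ≤ 1 := by nlinarith
  have hG : SuperClass (n + 1) r (thinObst n s k K) fun z => A * decayBarrier (n + 1) z := by
    refine ⟨?_, ⟨A, fun z => ?_⟩, fun z => ?_, fun z => ?_⟩
    · exact ((contDiff_one_add_norm_sq_rpow _).continuous.const_mul A |>.measurable)
    · rw [abs_of_nonneg (mul_nonneg (by linarith) (decayBarrier_pos z).le)]
      exact mul_le_of_le_one_right (by linarith) (decayBarrier_le_one z)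
    · rcases (thinObst_nonneg (s := s) (k := k) (K := K) z).eq_or_lt with h | h
      · rw [← h]
        exact mul_nonneg (by linarith) (decayBarrier_pos z).le
      · refine (thinObst_le_one hK hs z).trans (one_le_mul_decayBarrier (by linarith) ?_)
        have := norm_sq_le_of_thinObst_pos hK hs hR h
        nlinarith
    · rw [kerAvg_const_mul, mul_left_comm]
      exact mul_le_mul_of_nonneg_left (kerAvg_le_of_lapl_nonpos (contDiff_one_add_norm_sq_rpow _)
        one_pos hr.le fun z _ => lapl_decayBarrier_nonpos (by omega) z) (by linarith)
  have hlast : ∀ z : EuclideanSpace ℝ (Fin (n + 1)), z ∈ ball 0 (2 * A + 1) →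
      c * |z (Fin.last n)| ≤ 1 / 2 := by
    intro z hz
    rw [mem_ball_zero_iff] at hz
    rw [← hcR]
    exact mul_le_mul_of_nonneg_left ((abs_last_le_norm z).trans hz.le) hc0.le
  have hbc : Continuous fun z : EuclideanSpace ℝ (Fin (n + 1)) => 1 - c * |z (Fin.last n)| := by
    fun_prop
  refine ⟨_, superClass_glue (x₀ := 0) (ρ := 2 * A + 1) (ρ' := 2 * A) hr (by linarith)
    thinObst_nonneg hG (b := fun z => 1 - c * |z (Fin.last n)|) hbc ?_ ?_ ?_, ?_⟩
  · intro z hz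
    refine (thinObst_le hK hs z).trans (max_le ?_ (by linarith [hlast z hz]))
    nlinarith [abs_nonneg (z (Fin.last n))]
  · intro z _
    obtain ⟨σ, hσ, hσz⟩ : ∃ σ : ℝ, |σ| = 1 ∧ |z (Fin.last n)| = σ * z (Fin.last n) := by
      rcases abs_cases (z (Fin.last n)) with h | h
      · exact ⟨1, by simp, by linarith [h.1]⟩
      · exact ⟨-1, by simp, by linarith [h.1]⟩
    have hQ := contDiff_thinQuad (n := n) 1
      ((-(c * σ)) • EuclideanSpace.proj (𝕜 := ℝ) (Fin.last n)) 0 0 0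
    have hQv : ∀ y, thinQuad n 1 ((-(c * σ)) • EuclideanSpace.proj (𝕜 := ℝ) (Fin.last n)) 0 0 0 y =
        1 - c * (σ * y (Fin.last n)) := by
      intro y
      simp [thinQuad]
      ring
    have h1 := kerAvg_eq_of_lapl_eq_zero hQ one_pos hr.le (x := z)
      fun y => by rw [lapl_thinQuad]; ring
    rw [hQv, ← hσz] at h1
    rw [← h1]
    refine kerAvg_mono one_pos hr (integrable_kerAvg_of_continuous one_pos hbc r z)
      (integrable_kerAvg_of_continuous one_pos hQ.continuous r z) fun y _ => ?_
    rw [hQv]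
    have h2 : σ * y (Fin.last n) ≤ |y (Fin.last n)| := by
      refine (le_abs_self _).trans ?_
      rw [abs_mul, hσ, one_mul]
    nlinarith
  · intro z hz hz'
    rw [dist_zero_right] at hz'
    linarith [mul_decayBarrier_le hz', hlast z hz]
  · intro z hz
    simp only
    rw [if_pos (by rw [mem_ball_zero_iff]; linarith)]
    exact min_le_right _ _

lemma tangent_le_pow {S T : ℝ} (hS : 0 < S) (hT : 0 ≤ T) (k : ℕ) :
    S ^ (k + 1) + (k + 1) * S ^ k * (T - S) ≤ T ^ (k + 1) := by
  have hb := one_add_mul_le_pow (a := (T - S) / S) (by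
    rw [le_div_iff₀ hS]; linarith) (k + 1)
  have e1 : 1 + (T - S) / S = T / S := by field_simp; ring
  rw [e1, div_pow, le_div_iff₀ (by positivity)] at hb
  refine le_trans (le_of_eq ?_) hb
  push_cast
  field_simp
  ring

set_option maxHeartbeats 1000000 in
lemma exists_superClass_contact (hn : 2 ≤ n) (hK : 1 ≤ K) (hs : ∀ x, 1 / 2 ≤ s x) {R : ℝ}
    (hR0 : 0 ≤ R) (hR : ∀ x, s x < 1 → ‖x‖ ≤ R) {c : ℝ} (hc : c = 1 / (2 * (2 * (R + 3) + 1)))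
    {x' : EuclideanSpace ℝ (Fin n)} {L : EuclideanSpace ℝ (Fin n) →L[ℝ] ℝ} {C ε q : ℝ}
    (hC : 0 ≤ C) (hε : 0 < ε) (hεc : ε * (n + 1) ≤ c)
    (hL : ∀ y, ‖y‖ ≤ 1 → |L y| ≤ C ∧ |s (x' + y) - s x' - L y| ≤ C * ‖y‖ ^ 2)
    (hx : s x' ≤ q) (hq : q < 1)
    (hk : q ^ (k + 1) + C * ((k + 1) * q ^ k) ≤ ε / 4) {r : ℝ} (hr : 0 < r) (hr1 : r < 1 / 2) :
    ∃ w, SuperClass (n + 1) r (thinObst n s k K) w ∧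
      w (thinEmbed n x' 0) ≤ thinObst n s k K (thinEmbed n x' 0) := by
  obtain ⟨w, hw, hwle⟩ := exists_superClass_tent (k := k) hn hK hs hR0 hR hc hr (by linarith)
  set x₀ := thinEmbed n x' 0 with hx₀
  have hc0 : 0 < c := by rw [hc]; positivity
  have hc1 : c ≤ 1 / 2 := by
    rw [hc]
    exact one_div_le_one_div_of_le (by norm_num) (by linarith)
  have hx'R : ‖x'‖ ≤ R := hR _ (hx.trans_lt hq)
  have hx₀n : ‖x₀‖ = ‖x'‖ := by
    have := norm_sq_eq_thinProj x₀
    rw [hx₀, thinProj_thinEmbed, thinEmbed_last, ← hx₀] at this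
    exact (sq_eq_sq₀ (norm_nonneg _) (norm_nonneg _)).1 (by linarith)
  set S := s x' with hS
  have hS0 : 0 < S := by linarith [hs x']
  set D := ((k : ℝ) + 1) * S ^ k with hD
  have hD0 : 0 ≤ D := by positivity
  have hkS : S ^ (k + 1) + C * D ≤ ε / 4 := by
    refine le_trans ?_ hk
    rw [hD]
    gcongr
  have hSk : 0 ≤ S ^ (k + 1) := by positivity
  have hCD : 0 ≤ C * D := by positivity
  have hεn : ε * n ≤ 1 / 2 := by nlinarith
  set b := thinQuad n (1 - S ^ (k + 1)) (-(D • L.comp (thinProjL n))) ε (-(ε * n)) x₀ with hb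
  have hbv : ∀ z, b z = 1 - S ^ (k + 1) - D * L (thinProj n z - x') +
      (ε * ‖thinProj n z - x'‖ ^ 2 - ε * n * z (Fin.last n) ^ 2) := by
    intro z
    simp [hb, thinQuad, hx₀, thinProjL_apply, thinProj_sub]
    ring
  have hsub : ∀ z ∈ ball x₀ 1, ‖thinProj n z - x'‖ ≤ 1 ∧ |z (Fin.last n)| ≤ 1 ∧
      dist z x₀ ^ 2 = ‖thinProj n z - x'‖ ^ 2 + z (Fin.last n) ^ 2 := by
    intro z hz
    rw [mem_ball, dist_eq_norm] at hz
    have h1 := norm_thinProj_le (z - x₀)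
    have h2 := abs_last_le_norm (z - x₀)
    have h3 := norm_sq_eq_thinProj (z - x₀)
    rw [thinProj_sub, hx₀, thinProj_thinEmbed, ← hx₀] at h1 h3
    have h4 : (z - x₀) (Fin.last n) = z (Fin.last n) := by simp [hx₀]
    rw [h4] at h2 h3
    exact ⟨h1.trans hz.le, h2.trans hz.le, by rw [dist_eq_norm, h3]⟩
  have hDL : ∀ z ∈ ball x₀ 1, D * L (thinProj n z - x') ≤ C * D := by
    intro z hz
    have := (abs_le.1 (hL _ (hsub z hz).1).1).2
    nlinarith
  refine ⟨_, superClass_glue (x₀ := x₀) (ρ := 1) (ρ' := 1 / 2) hr (by linarith) thinObst_nonneg hw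
    (b := b) (contDiff_thinQuad _ _ _ _ _).continuous ?_ ?_ ?_, ?_⟩
  · intro z hz
    obtain ⟨h1, h2, h3⟩ := hsub z hz
    have h4 := hDL z hz
    have ht2 : z (Fin.last n) ^ 2 ≤ |z (Fin.last n)| := by
      rw [← sq_abs]
      nlinarith [abs_nonneg (z (Fin.last n))]
    have hn0 : 0 ≤ ε * n := by positivity
    rw [hbv]
    refine max_le ?_ ?_
    · have h5 := (abs_le.1 (hL _ h1).2).1
      rw [add_sub_cancel] at h5
      have hsz := hs (thinProj n z)
      set T := s (thinProj n z)
      have hconv : S ^ (k + 1) + D * (T - S) ≤ T ^ (k + 1) :=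
        tangent_le_pow hS0 (by linarith) k
      have hp := profile_le_one_sub (z (Fin.last n))
      rw [max_eq_left (by linarith : 0 ≤ 1 - |z (Fin.last n)|)] at hp
      unfold rawObst
      rw [max_eq_left (by linarith : 0 ≤ 1 - |z (Fin.last n)|)]
      have e2 : K * ((1 - |z (Fin.last n)|) ^ 2 - 1) ≤ -|z (Fin.last n)| := by
        nlinarith [abs_nonneg (z (Fin.last n))]
      have e3 : D * (L (thinProj n z - x') - C * ‖thinProj n z - x'‖ ^ 2) ≤ D * (T - S) :=
        mul_le_mul_of_nonneg_left (by linarith) hD0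
      have e4 : C * D * ‖thinProj n z - x'‖ ^ 2 ≤ ε * ‖thinProj n z - x'‖ ^ 2 :=
        mul_le_mul_of_nonneg_right (by linarith) (sq_nonneg _)
      have e5 : ε * n * z (Fin.last n) ^ 2 ≤ 1 / 2 * |z (Fin.last n)| :=
        mul_le_mul hεn ht2 (sq_nonneg _) (by norm_num)
      have e6 : D * (L (thinProj n z - x') - C * ‖thinProj n z - x'‖ ^ 2) =
        D * L (thinProj n z - x') - C * D * ‖thinProj n z - x'‖ ^ 2 := by ring
      linarith [abs_nonneg (z (Fin.last n))]
    · have e1 : ε * n * z (Fin.last n) ^ 2 ≤ ε * n := by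
        refine mul_le_of_le_one_right hn0 (ht2.trans h2)
      have e2 : 0 ≤ ε * ‖thinProj n z - x'‖ ^ 2 := by positivity
      have e3 : ε * (n + 1) = ε * n + ε := by ring
      linarith
  · intro z _
    exact kerAvg_le_of_lapl_nonpos (contDiff_thinQuad _ _ _ _ _) one_pos hr.le fun y _ => by
      rw [lapl_thinQuad]
      linarith
  · intro z hz hz2
    obtain ⟨h1, h2, h3⟩ := hsub z hz
    have h4 := hDL z hz
    have hzR : ‖z‖ < R + 1 := by
      rw [mem_ball, dist_eq_norm] at hz
      linarith [norm_le_norm_add_norm_sub' z x₀]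
    refine (hwle z hzR).trans ?_
    rw [hbv]
    have ht2 : z (Fin.last n) ^ 2 ≤ |z (Fin.last n)| := by
      rw [← sq_abs]
      nlinarith [abs_nonneg (z (Fin.last n))]
    have h5 : 1 / 4 ≤ ‖thinProj n z - x'‖ ^ 2 + z (Fin.last n) ^ 2 := by
      rw [← h3]
      nlinarith
    have h6 : ε * (n + 1) * z (Fin.last n) ^ 2 ≤ c * |z (Fin.last n)| :=
      mul_le_mul hεc ht2 (sq_nonneg _) hc0.le
    have h7 := mul_le_mul_of_nonneg_left h5 hε.le
    have h8 : ε * (n + 1) * z (Fin.last n) ^ 2 =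
      ε * n * z (Fin.last n) ^ 2 + ε * z (Fin.last n) ^ 2 := by ring
    linarith
  · rw [if_pos (mem_ball_self one_pos)]
    refine (min_le_right _ _).trans ?_
    rw [hbv]
    refine le_trans (le_of_eq ?_) (le_max_left _ _)
    rw [hx₀, rawObst_thinEmbed_zero]
    simp [hS]

end Obstacle

section Envelope

variable {n : ℕ} {s : EuclideanSpace ℝ (Fin n) → ℝ} {k : ℕ} {K : ℝ}

lemma rawObst_lt_of_kerAvg_le {V : EuclideanSpace ℝ (Fin (n + 1)) → ℝ} (hV : Continuous V)
    (hsup : ∀ c r x, 0 < c → 0 ≤ r → kerAvg (n + 1) c r V x ≤ kerMass (n + 1) c * V x)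
    (hle : ∀ z, rawObst n s k K z ≤ V z) {x : EuclideanSpace ℝ (Fin (n + 1))}
    (hx0 : x (Fin.last n) ≠ 0) (hx1 : |x (Fin.last n)| < 1)
    {L : EuclideanSpace ℝ (Fin n) →L[ℝ] ℝ} {C : ℝ}
    (hL : ∀ y, ‖y‖ ≤ 1 →
      |s (thinProj n x + y) ^ (k + 1) - s (thinProj n x) ^ (k + 1) - L y| ≤ C * ‖y‖ ^ 2)
    (hK : n * C < K) : rawObst n s k K x < V x := by
  refine lt_of_le_of_ne (hle x) fun heq => ?_
  obtain ⟨σ, hσ, hσx⟩ : ∃ σ : ℝ, σ ^ 2 = 1 ∧ |x (Fin.last n)| = σ * x (Fin.last n) := by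
    rcases abs_cases (x (Fin.last n)) with h | h
    · exact ⟨1, by simp, by linarith [h.1]⟩
    · exact ⟨-1, by simp, by linarith [h.1]⟩
  set r := min |x (Fin.last n)| (1 - |x (Fin.last n)|) with hr
  have hr0 : 0 < r := lt_min (abs_pos.2 hx0) (by linarith)
  have hr1 : r ≤ 1 := (min_le_left _ _).trans hx1.le
  set Q := thinQuad n (rawObst n s k K x)
    (-(L.comp (thinProjL n)) +
      (2 * K * (x (Fin.last n) - σ)) • EuclideanSpace.proj (𝕜 := ℝ) (Fin.last n)) (-C) K x with hQ
  have hQd : ContDiff ℝ 2 Q := contDiff_thinQuad _ _ _ _ _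
  have hQV : ∀ z ∈ ball x r, Q z ≤ V z := by
    intro z hz
    refine le_trans ?_ (hle z)
    rw [mem_ball, dist_eq_norm] at hz
    have h1 : ‖thinProj n z - thinProj n x‖ ≤ 1 := by
      rw [← thinProj_sub]
      exact (norm_thinProj_le _).trans (hz.le.trans hr1)
    have h2 : |z (Fin.last n) - x (Fin.last n)| < r := by
      simpa using (abs_last_le_norm (z - x)).trans_lt hz
    have h3 : |z (Fin.last n)| = σ * z (Fin.last n) := by
      have hra := h2.trans_le (min_le_left _ _)
      have hσ' : σ = 1 ∨ σ = -1 := by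
        rcases mul_eq_zero.1 (show (σ - 1) * (σ + 1) = 0 by linear_combination hσ) with h | h
        · exact .inl (by linarith)
        · exact .inr (by linarith)
      rw [abs_lt, hσx] at hra
      rcases hσ' with rfl | rfl
      · rw [abs_of_nonneg (by linarith)]; ring
      · rw [abs_of_nonpos (by linarith)]; ring
    have h4 : |z (Fin.last n)| ≤ 1 := by
      have hrb := h2.trans_le (min_le_right _ _)
      linarith [abs_sub_abs_le_abs_sub (z (Fin.last n)) (x (Fin.last n))]
    have h5 := (abs_le.1 (hL _ h1)).2
    rw [add_sub_cancel] at h5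
    have h6 : Q z = rawObst n s k K x + (-L (thinProj n z - thinProj n x) +
        2 * K * (x (Fin.last n) - σ) * (z (Fin.last n) - x (Fin.last n))) +
        (-C * ‖thinProj n z - thinProj n x‖ ^ 2 +
          K * (z (Fin.last n) - x (Fin.last n)) ^ 2) := by
      simp [hQ, thinQuad, thinProjL_apply, thinProj_sub]
    rw [h6]
    unfold rawObst
    rw [max_eq_left (by linarith : 0 ≤ 1 - |z (Fin.last n)|),
      max_eq_left (by linarith : 0 ≤ 1 - |x (Fin.last n)|), h3, hσx]
    have h7 : K * ((1 - σ * z (Fin.last n)) ^ 2 - 1) = K * ((1 - σ * x (Fin.last n)) ^ 2 - 1) +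
        2 * K * (x (Fin.last n) - σ) * (z (Fin.last n) - x (Fin.last n)) +
        K * (z (Fin.last n) - x (Fin.last n)) ^ 2 := by
      linear_combination K * (z (Fin.last n) ^ 2 - x (Fin.last n) ^ 2) * hσ
    linarith
  have hQx : Q x = V x := by
    rw [← heq]
    simp [hQ, thinQuad]
  have h1 := le_kerAvg_of_le_lapl hQd one_pos (x := x) (b := 2 * (n * (-C) + K)) hr0.le
    fun z _ => (lapl_thinQuad _ _ _ _ _ _).ge
  have h2 := kerAvg_mono one_pos hr0 (integrable_kerAvg_of_continuous one_pos hQd.continuous r x)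
    (integrable_kerAvg_of_continuous one_pos hV r x) hQV
  have h3 := hsup 1 r x one_pos hr0.le
  have h4 : 0 < 2 * (n * (-C) + K) * potMass (n + 1) 1 * (r ^ 2 / 2) :=
    mul_pos (mul_pos (by linarith) (potMass_pos one_pos)) (by positivity)
  rw [hQx] at h1
  linarith

lemma pos_of_kerAvg_le {d : ℕ} {V : EuclideanSpace ℝ (Fin d) → ℝ} (hV : Continuous V)
    (hV0 : ∀ x, 0 ≤ V x)
    (hsup : ∀ c r x, 0 < c → 0 ≤ r → kerAvg d c r V x ≤ kerMass d c * V x)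
    {x₁ : EuclideanSpace ℝ (Fin d)} (hx₁ : 0 < V x₁) (x : EuclideanSpace ℝ (Fin d)) :
    0 < V x := by
  refine lt_of_le_of_ne (hV0 x) fun h => ?_
  set r := dist x₁ x + 1 with hr
  have hr0 : 0 < r := by positivity
  have h1 := hsup 1 r x one_pos hr0.le
  rw [← h, mul_zero] at h1
  refine absurd h1 (not_le.2 ?_)
  refine Continuous.integral_pos_of_hasCompactSupport_nonneg_nonzero (x := r⁻¹ • (x₁ - x))
    ((hV.comp (by fun_prop)).mul continuous_radialKer)
    (hasCompactSupport_radialKer one_pos).mul_left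
    (fun y => mul_nonneg (hV0 _) (radialKer_nonneg y)) ?_
  have h2 : ‖r⁻¹ • (x₁ - x)‖ < 1 := by
    rw [norm_smul, norm_inv, Real.norm_of_nonneg hr0.le, ← dist_eq_norm, inv_mul_lt_one₀ hr0]
    linarith
  have h3 : x + r • r⁻¹ • (x₁ - x) = x₁ := by
    rw [smul_inv_smul₀ hr0.ne', add_sub_cancel]
  rw [h3]
  exact (mul_pos hx₁ (radialKer_pos one_pos h2)).ne'

lemma exists_pow_add_mul_pow_le {q : ℝ} (hq0 : 0 ≤ q) (hq1 : q < 1) (C : ℝ) {e : ℝ} (he : 0 < e) :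
    ∃ k : ℕ, q ^ (k + 1) + C * ((k + 1) * q ^ k) ≤ e := by
  have h1 := tendsto_pow_atTop_nhds_zero_of_lt_one hq0 hq1
  have h2 := tendsto_self_mul_const_pow_of_lt_one hq0 hq1
  have h3 := (h1.comp (tendsto_add_atTop_nat 1)).add ((h2.add h1).const_mul C)
  simp only [add_zero, mul_zero] at h3
  obtain ⟨k, hk⟩ := (h3.eventually_le_const he).exists
  refine ⟨k, le_trans (le_of_eq ?_) hk⟩
  simp only [Function.comp]
  ring

theorem exists_thin_envelope (hn : 2 ≤ n) (hs : ContDiff ℝ 2 s) (hs0 : ∀ x, 1 / 2 ≤ s x) {R : ℝ}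
    (hR : ∀ x, s x < 1 → ‖x‖ ≤ R) {q : ℝ} (hq1 : q < 1) (hq : ∃ x, s x ≤ q) :
    ∃ (k : ℕ) (V : EuclideanSpace ℝ (Fin (n + 1)) → ℝ), Continuous V ∧
      (∀ z, 0 < V z) ∧ (∀ z, V z ≤ 1) ∧
      (∀ c r x, 0 < c → 0 ≤ r → kerAvg (n + 1) c r V x ≤ kerMass (n + 1) c * V x) ∧
      (∀ x' t, V (thinEmbed n x' t) = V (thinEmbed n x' (-t))) ∧
      (∀ x', 1 - s x' ^ (k + 1) ≤ V (thinEmbed n x' 0)) ∧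
      (∀ z, z (Fin.last n) ≠ 0 ∨ V z ≠ 1 - s (thinProj n z) ^ (k + 1) →
        ContDiffAt ℝ 2 V z ∧ lapl (n + 1) V z = 0) ∧
      ∀ x', s x' ≤ q → V (thinEmbed n x' 0) = 1 - s x' ^ (k + 1) := by
  obtain ⟨x₁, hx₁⟩ := hq
  have hq0 : 0 ≤ q := by linarith [hs0 x₁]
  have hR0 : 0 ≤ R := (norm_nonneg _).trans (hR x₁ (hx₁.trans_lt hq1))
  obtain ⟨c, hc⟩ : ∃ c, c = 1 / (2 * (2 * (R + 3) + 1)) := ⟨_, rfl⟩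
  have hc0 : 0 < c := by rw [hc]; positivity
  set ε := c / (n + 1) with hε
  have hε0 : 0 < ε := by positivity
  have hεc : ε * (n + 1) ≤ c := by rw [hε, div_mul_cancel₀ _ (by positivity)]
  obtain ⟨C, hC, hCL⟩ := exists_taylor_bound hs R
  obtain ⟨k, hk⟩ := exists_pow_add_mul_pow_le hq0 hq1 C (e := ε / 4) (by positivity)
  obtain ⟨C', hC', hCL'⟩ := exists_taylor_bound (hs.pow (k + 1)) R
  set K : ℝ := n * C' + 1 with hKdef
  have hK : 1 ≤ K := by
    have : 0 ≤ n * C' := by positivity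
    linarith
  obtain ⟨V, hVc, hψV, hV1, hsup, hharm, hsymm, hcontact⟩ :=
    exists_obstacle_solution (thinObst_nonneg (s := s) (k := k) (K := K)) (thinObst_le_one hK hs0)
      (uniformContinuous_thinObst hs.continuous hK hs0 hR)
  have hraw : ∀ z, rawObst n s k K z ≤ V z := fun z => (le_max_left _ _).trans (hψV z)
  have hpow : ∀ x', s x' < 1 → s x' ^ (k + 1) < 1 := fun x' hx' =>
    pow_lt_one₀ (by linarith [hs0 x']) hx' (by omega)
  have hpos : ∀ z, 0 < V z := by
    refine pos_of_kerAvg_le hVc (fun z => (thinObst_nonneg z).trans (hψV z)) hsup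
      (x₁ := thinEmbed n x₁ 0) (lt_of_lt_of_le ?_ (hraw _))
    rw [rawObst_thinEmbed_zero]
    linarith [hpow x₁ (hx₁.trans_lt hq1)]
  refine ⟨k, V, hVc, hpos, hV1, hsup, ?_, ?_, ?_, ?_⟩
  · intro x' t
    rw [← flipLast_thinEmbed]
    exact (hsymm (flipLast n) thinObst_flipLast flipLast_flipLast _).symm
  · intro x'
    rw [← rawObst_thinEmbed_zero (K := K)]
    exact hraw _
  · intro z hz
    refine hharm z (lt_of_le_of_ne (hψV z) fun heq => ?_)
    have hψpos : 0 < thinObst n s k K z := heq ▸ hpos z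
    have hrz : rawObst n s k K z = V z := by
      rw [← heq]
      rcases max_choice (rawObst n s k K z) 0 with h | h
      · exact h.symm
      · exact absurd h hψpos.ne'
    rcases eq_or_ne (z (Fin.last n)) 0 with h0 | h0
    · rcases hz with hz | hz
      · exact hz h0
      · refine hz ?_
        rw [← hrz]
        simp [rawObst, h0]
    · obtain ⟨L, hL⟩ := hCL' (thinProj n z) (hR _ (lt_one_of_thinObst_pos hK hψpos))
      exact (rawObst_lt_of_kerAvg_le hVc hsup hraw h0 (abs_last_lt_of_thinObst_pos hK hs0 hψpos)
        (fun y hy => (hL y hy).2) (by linarith)).ne hrz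
  · intro x' hx'
    have hxq := hx'.trans_lt hq1
    obtain ⟨L, hL⟩ := hCL x' (hR _ hxq)
    rw [hcontact (thinEmbed n x' 0) ⟨1 / 2, by norm_num, fun r hr hr2 =>
      exists_superClass_contact hn hK hs0 hR0 hR hc hC hε0 hεc hL hx' hq1 hk hr hr2⟩, thinObst,
      rawObst_thinEmbed_zero, max_eq_left]
    linarith [hpow x' hxq]

end Envelope

section PolynomialCalculus

variable {d : ℕ}

lemma pev_C (a : ℝ) : pev (MvPolynomial.C a : MvPolynomial (Fin d) ℝ) = fun _ => a := by
  ext y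
  simp [pev]

lemma pev_add (p q : MvPolynomial (Fin d) ℝ) : pev (p + q) = fun y => pev p y + pev q y := by
  ext y
  simp [pev]

lemma pev_mul (p q : MvPolynomial (Fin d) ℝ) : pev (p * q) = fun y => pev p y * pev q y := by
  ext y
  simp [pev]

lemma pev_X (j : Fin d) : pev (MvPolynomial.X j : MvPolynomial (Fin d) ℝ) = fun y => y j := by
  ext y
  simp [pev]

lemma hasFDerivAt_pev (p : MvPolynomial (Fin d) ℝ) (x : EuclideanSpace ℝ (Fin d)) :
    HasFDerivAt (pev p) (∑ i, pev (MvPolynomial.pderiv i p) x •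
      (EuclideanSpace.proj i : EuclideanSpace ℝ (Fin d) →L[ℝ] ℝ)) x := by
  classical
  induction p using MvPolynomial.induction_on with
  | C a =>
    rw [pev_C]
    refine (hasFDerivAt_const a x).congr_fderiv ?_
    simp [pev]
  | add p q hp hq =>
    rw [pev_add]
    refine (hp.add hq).congr_fderiv ?_
    simp only [map_add, pev_add, add_smul, Finset.sum_add_distrib]
  | mul_X p j hp =>
    rw [pev_mul, pev_X]
    refine (hp.mul
      (EuclideanSpace.proj j : EuclideanSpace ℝ (Fin d) →L[ℝ] ℝ).hasFDerivAt).congr_fderiv ?_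
    have h1 : ∀ i, pev (MvPolynomial.pderiv i (p * MvPolynomial.X j)) x =
        x j * pev (MvPolynomial.pderiv i p) x + if i = j then pev p x else 0 := by
      intro i
      rw [MvPolynomial.pderiv_mul, MvPolynomial.pderiv_X, pev_add, pev_mul, pev_mul, pev_X]
      rcases eq_or_ne i j with rfl | hij
      · simp [pev]
        ring
      · simp [pev, hij, mul_comm]
    simp only [h1, add_smul, Finset.sum_add_distrib, ite_smul, zero_smul, Finset.sum_ite_eq',
      Finset.mem_univ, if_true, mul_smul, Finset.smul_sum]
    exact add_comm _ _

lemma fderiv_pev_single (p : MvPolynomial (Fin d) ℝ) (x : EuclideanSpace ℝ (Fin d)) (i : Fin d) :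
    fderiv ℝ (pev p) x (EuclideanSpace.single i 1) = pev (MvPolynomial.pderiv i p) x := by
  rw [(hasFDerivAt_pev p x).fderiv]
  simp

lemma contDiff_pev (p : MvPolynomial (Fin d) ℝ) : ContDiff ℝ 2 (pev p) := by
  induction p using MvPolynomial.induction_on with
  | C a =>
    rw [pev_C]
    exact contDiff_const
  | add p q hp hq =>
    rw [pev_add]
    exact hp.add hq
  | mul_X p j hp =>
    rw [pev_mul, pev_X]
    exact hp.mul (EuclideanSpace.proj j : EuclideanSpace ℝ (Fin d) →L[ℝ] ℝ).contDiff

/-- The Laplacian on polynomials. -/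
def polyLapl (d : ℕ) : Module.End ℝ (MvPolynomial (Fin d) ℝ) :=
  ∑ i, (MvPolynomial.pderiv i).toLinearMap ∘ₗ (MvPolynomial.pderiv i).toLinearMap

lemma polyLapl_apply (p : MvPolynomial (Fin d) ℝ) :
    polyLapl d p = ∑ i, MvPolynomial.pderiv i (MvPolynomial.pderiv i p) := by
  simp [polyLapl]

lemma lapl_pev (p : MvPolynomial (Fin d) ℝ) (x : EuclideanSpace ℝ (Fin d)) :
    lapl d (pev p) x = pev (polyLapl d p) x := by
  simp only [lapl, fderiv_pev_single, polyLapl_apply, pev, map_sum]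
  exact Finset.sum_congr rfl fun i _ => fderiv_pev_single (MvPolynomial.pderiv i p) x i

lemma exists_polyLapl_pow_eq_zero (p : MvPolynomial (Fin d) ℝ) :
    ∃ m : ℕ, (polyLapl d ^ m) p = 0 := by
  classical
  have hmem : ∀ q, q ∈ (polyLapl d).maxGenEigenspace 0 ↔ ∃ m : ℕ, (polyLapl d ^ m) q = 0 := by
    intro q
    rw [Module.End.mem_maxGenEigenspace]
    simp
  rw [← hmem]
  have hmono : ∀ (N : ℕ) (e : Fin d →₀ ℕ) (a : ℝ), e.degree = N →
      MvPolynomial.monomial e a ∈ (polyLapl d).maxGenEigenspace 0 := by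
    intro N
    induction N using Nat.strong_induction_on with
    | _ N ih =>
      intro e a he
      have h1 : polyLapl d (MvPolynomial.monomial e a) ∈ (polyLapl d).maxGenEigenspace 0 := by
        rw [polyLapl_apply]
        refine Submodule.sum_mem _ fun i _ => ?_
        rw [MvPolynomial.pderiv_monomial, MvPolynomial.pderiv_monomial]
        rcases Nat.eq_zero_or_pos (e i) with h0 | h0
        · simp [h0]
        · refine ih _ ?_ _ _ rfl
          rw [← he]
          refine lt_of_le_of_lt (b := (e - Finsupp.single i 1).degree) ?_ ?_
          · exact Finsupp.degree_mono tsub_le_self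
          · have h2 : (e - Finsupp.single i 1) + Finsupp.single i 1 = e :=
              tsub_add_cancel_of_le (by simpa using Nat.one_le_iff_ne_zero.2 h0.ne')
            conv_rhs => rw [← h2]
            rw [map_add, Finsupp.degree_single]
            omega
      obtain ⟨m, hm⟩ := (hmem _).1 h1
      exact (hmem _).2 ⟨m + 1, by rw [pow_succ]; exact hm⟩
  rw [p.as_sum]
  exact Submodule.sum_mem _ fun e _ => hmono _ e _ rfl

lemma hasPolyGrowth_pev (p : MvPolynomial (Fin d) ℝ) : HasPolyGrowth d (pev p) := by
  have key : ∃ (m : ℕ) (C : ℝ), 0 ≤ C ∧ ∀ x, |pev p x| ≤ C * (1 + ‖x‖) ^ m := by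
    induction p using MvPolynomial.induction_on with
    | C a => exact ⟨0, |a|, abs_nonneg a, fun x => by simp [pev]⟩
    | add p q hp hq =>
      obtain ⟨m, C, hC, h⟩ := hp
      obtain ⟨m', C', hC', h'⟩ := hq
      refine ⟨m + m', C + C', by positivity, fun x => ?_⟩
      have h1 : (1 : ℝ) ≤ 1 + ‖x‖ := by linarith [norm_nonneg x]
      have e1 : (1 + ‖x‖) ^ m ≤ (1 + ‖x‖) ^ (m + m') := pow_le_pow_right₀ h1 (by omega)
      have e2 : (1 + ‖x‖) ^ m' ≤ (1 + ‖x‖) ^ (m + m') := pow_le_pow_right₀ h1 (by omega)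
      rw [pev_add, add_mul]
      exact (abs_add_le _ _).trans (add_le_add
        ((h x).trans (mul_le_mul_of_nonneg_left e1 hC))
        ((h' x).trans (mul_le_mul_of_nonneg_left e2 hC')))
    | mul_X p j hp =>
      obtain ⟨m, C, hC, h⟩ := hp
      refine ⟨m + 1, C, hC, fun x => ?_⟩
      have e2 : |x j| ≤ 1 + ‖x‖ := by
        have := PiLp.norm_apply_le x j
        rw [Real.norm_eq_abs] at this
        linarith
      rw [pev_mul, pev_X, abs_mul, pow_succ, ← mul_assoc]
      exact mul_le_mul (h x) e2 (abs_nonneg _) (by positivity)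
  obtain ⟨m, C, hC, h⟩ := key
  refine ⟨m, C * 2 ^ (m - 1), fun x => (h x).trans ?_⟩
  rw [mul_assoc]
  refine mul_le_mul_of_nonneg_left ?_ hC
  simpa using add_pow_le zero_le_one (norm_nonneg x) m

end PolynomialCalculus

section HarmonicExtension

open MvPolynomial

variable {n : ℕ}

lemma polyLapl_X_pow_mul_rename (a : ℕ) (h : MvPolynomial (Fin n) ℝ) :
    polyLapl (n + 1) (X (Fin.last n) ^ a * rename Fin.castSucc h) =
      C ((a : ℝ) * ((a - 1 : ℕ) : ℝ)) * X (Fin.last n) ^ (a - 2) * rename Fin.castSucc h +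
        X (Fin.last n) ^ a * rename Fin.castSucc (polyLapl n h) := by
  have hlast : ∀ q : MvPolynomial (Fin n) ℝ,
      pderiv (Fin.last n) (rename Fin.castSucc q) = 0 := by
    classical
    intro q
    refine pderiv_eq_zero_of_notMem_vars fun hmem => ?_
    obtain ⟨i, -, hi⟩ := Finset.mem_image.1 (vars_rename _ _ hmem)
    exact (Fin.castSucc_lt_last i).ne hi
  have hd : ∀ (b : ℕ) (q : MvPolynomial (Fin n) ℝ),
      pderiv (Fin.last n) (X (Fin.last n) ^ b * rename Fin.castSucc q) =
        C (b : ℝ) * (X (Fin.last n) ^ (b - 1) * rename Fin.castSucc q) := by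
    intro b q
    rw [pderiv_mul, pderiv_pow, hlast, pderiv_X_self, map_natCast]
    ring
  have hX : ∀ (b : ℕ) (i : Fin n),
      pderiv i.castSucc (X (Fin.last n) ^ b : MvPolynomial (Fin (n + 1)) ℝ) = 0 := by
    intro b i
    rw [pderiv_pow, pderiv_X_of_ne (Fin.castSucc_lt_last i).ne', mul_zero]
  have hcast : ∀ (q : MvPolynomial (Fin n) ℝ) (i : Fin n),
      pderiv i.castSucc (rename Fin.castSucc q) = rename Fin.castSucc (pderiv i q) :=
    fun q i => pderiv_rename (Fin.castSucc_injective n) i q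
  rw [polyLapl_apply, Fin.sum_univ_castSucc, polyLapl_apply, map_sum, Finset.mul_sum,
    add_comm (∑ i : Fin n, _)]
  congr 1
  · rw [hd, pderiv_C_mul, hd, Nat.sub_sub, map_mul]
    ring
  · refine Finset.sum_congr rfl fun i _ => ?_
    simp only [pderiv_mul, hX, hcast, zero_mul, zero_add]

lemma exists_harmonic_extension (g : MvPolynomial (Fin n) ℝ) :
    ∃ p : MvPolynomial (Fin (n + 1)) ℝ, polyLapl (n + 1) p = 0 ∧
      (∀ x', pev p (thinEmbed n x' 0) = pev g x') ∧
      ∀ x' t, pev p (thinEmbed n x' t) = pev p (thinEmbed n x' (-t)) := by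
  have key : ∀ m : ℕ, ∃ p : MvPolynomial (Fin (n + 1)) ℝ,
      (∃ a : ℝ, polyLapl (n + 1) p =
        C a * (X (Fin.last n) ^ (2 * m) * rename Fin.castSucc ((polyLapl n ^ (m + 1)) g))) ∧
      (∀ x', pev p (thinEmbed n x' 0) = pev g x') ∧
      ∀ x' t, pev p (thinEmbed n x' t) = pev p (thinEmbed n x' (-t)) := by
    have hev : ∀ (q : MvPolynomial (Fin n) ℝ) (x' : EuclideanSpace ℝ (Fin n)) (t : ℝ),
        pev (rename Fin.castSucc q) (thinEmbed n x' t) = pev q x' := by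
      intro q x' t
      simp [pev, eval_rename, Function.comp_def]
    intro m
    induction m with
    | zero =>
      refine ⟨rename Fin.castSucc g, ⟨1, ?_⟩, fun x' => hev g x' 0, fun x' t => ?_⟩
      · simpa using polyLapl_X_pow_mul_rename 0 g
      · rw [hev, hev]
    | succ m ih =>
      obtain ⟨p, ⟨a, ha⟩, h0, hev'⟩ := ih
      set h := (polyLapl n ^ (m + 1)) g with hh
      set b : ℝ := -(a / ((2 * m + 2) * (2 * m + 1))) with hb
      have hadd : ∀ z, pev (p + C b * (X (Fin.last n) ^ (2 * (m + 1)) * rename Fin.castSucc h)) z =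
          pev p z + b * (z (Fin.last n) ^ (2 * (m + 1)) * pev (rename Fin.castSucc h) z) := by
        intro z
        simp [pev]
      refine ⟨p + C b * (X (Fin.last n) ^ (2 * (m + 1)) * rename Fin.castSucc h), ⟨b, ?_⟩, ?_, ?_⟩
      · rw [map_add, ha, ← smul_eq_C_mul, ← smul_eq_C_mul, map_smul, polyLapl_X_pow_mul_rename,
          pow_succ' _ (m + 1), Module.End.mul_apply, ← hh, smul_add, ← add_assoc,
          show 2 * (m + 1) - 2 = 2 * m by omega, show 2 * (m + 1) - 1 = 2 * m + 1 by omega,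
          mul_assoc, ← smul_eq_C_mul (R := ℝ), smul_smul, ← add_smul, ← smul_eq_C_mul]
        have hab : a + b * (((2 * (m + 1) : ℕ) : ℝ) * ((2 * m + 1 : ℕ) : ℝ)) = 0 := by
          rw [hb]
          push_cast
          field_simp
          ring
        rw [hab, zero_smul, zero_add]
      · intro x'
        rw [hadd, h0, thinEmbed_last]
        simp
      · intro x' t
        rw [hadd, hadd, hev, hev, ← hev', thinEmbed_last, thinEmbed_last,
          (even_two_mul (m + 1)).neg_pow]
  obtain ⟨m, hm⟩ := exists_polyLapl_pow_eq_zero g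
  obtain ⟨p, ⟨a, ha⟩, h⟩ := key m
  refine ⟨p, ?_, h⟩
  rw [ha, pow_succ', Module.End.mul_apply, hm]
  simp

end HarmonicExtension

section Solution

lemma lapl_add {d : ℕ} {f g : EuclideanSpace ℝ (Fin d) → ℝ} {x : EuclideanSpace ℝ (Fin d)}
    (hf : ContDiffAt ℝ 2 f x) (hg : ContDiffAt ℝ 2 g x) :
    lapl d (fun y => f y + g y) x = lapl d f x + lapl d g x := by
  have hdiff : ∀ {h : EuclideanSpace ℝ (Fin d) → ℝ}, ContDiffAt ℝ 2 h x → ∀ v,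
      DifferentiableAt ℝ (fun y => fderiv ℝ h y v) x := fun hh v =>
    ((hh.fderiv_right (m := 1) (by norm_num)).differentiableAt (by norm_num)).clm_apply
      (differentiableAt_const v)
  have hev : ∀ {h : EuclideanSpace ℝ (Fin d) → ℝ}, ContDiffAt ℝ 2 h x →
      ∀ᶠ y in 𝓝 x, DifferentiableAt ℝ h y := fun hh =>
    (hh.eventually (by simp)).mono fun y hy => hy.differentiableAt (by norm_num)
  unfold lapl
  rw [← Finset.sum_add_distrib]
  refine Finset.sum_congr rfl fun i _ => ?_
  have h1 : (fun y => fderiv ℝ (fun y => f y + g y) y (EuclideanSpace.single i 1)) =ᶠ[𝓝 x]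
      fun y => fderiv ℝ f y (EuclideanSpace.single i 1) +
        fderiv ℝ g y (EuclideanSpace.single i 1) := by
    filter_upwards [hev hf, hev hg] with y hfy hgy
    rw [fderiv_fun_add hfy hgy]
    rfl
  rw [h1.fderiv_eq, fderiv_fun_add (hdiff hf _) (hdiff hg _)]
  rfl

variable {n : ℕ}

lemma exists_solution_of_sublevel_empty (S T : Set (EuclideanSpace ℝ (Fin n))) (hS : S = ∅) :
    ∃ u : EuclideanSpace ℝ (Fin (n + 1)) → ℝ,
      IsGlobalSolution n (fun _ => 0) u ∧ HasPolyGrowth (n + 1) u ∧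
      thinSet n S ⊆ contactSet n (fun _ => 0) u ∧ contactSet n (fun _ => 0) u ⊆ thinSet n T := by
  refine ⟨fun _ => 1, ⟨continuous_const, fun _ _ => rfl, fun _ => zero_le_one,
    ⟨contDiffOn_const, fun x _ => by simp [lapl]⟩, ?_⟩, ⟨0, 1, fun x => by simp⟩, ?_, ?_⟩
  · exact superMeanVal_of_kerAvg_le continuous_const fun c s x _ _ => by
      rw [kerAvg_const, mul_comm]
  · simp [hS, thinSet]
  · rintro x ⟨-, hx⟩
    exact absurd hx one_ne_zero

theorem exists_solution_of_polynomial (hn : 2 ≤ n) (S : MvPolynomial (Fin n) ℝ)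
    (hS0 : ∀ x, 1 / 2 ≤ pev S x) {R : ℝ} (hR : ∀ x, pev S x < 1 → ‖x‖ ≤ R) {q : ℝ} (hq1 : q < 1)
    (hq : ∃ x, pev S x ≤ q) :
    ∃ u : EuclideanSpace ℝ (Fin (n + 1)) → ℝ,
      IsGlobalSolution n (fun _ => 0) u ∧ HasPolyGrowth (n + 1) u ∧
      thinSet n {x' | pev S x' ≤ q} ⊆ contactSet n (fun _ => 0) u ∧
      contactSet n (fun _ => 0) u ⊆ thinSet n {x' | pev S x' ≤ 1} := by
  obtain ⟨k, V, hVc, hV0, hV1, hsup, heven, hge, hharm, hcontact⟩ :=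
    exists_thin_envelope hn (contDiff_pev S) hS0 hR hq1 hq
  obtain ⟨p, hp0, hpg, hpe⟩ := exists_harmonic_extension (S ^ (k + 1) - 1)
  have hg : ∀ x', pev (S ^ (k + 1) - 1) x' = pev S x' ^ (k + 1) - 1 := fun x' => by simp [pev]
  simp only [hg] at hpg
  have hlapl : ∀ z, lapl (n + 1) (pev p) z = 0 := fun z => by simp [lapl_pev, hp0, pev]
  have hpc := (contDiff_pev p).continuous
  have hoff : ∀ z ∈ (contactSet n (fun _ => 0) fun z => pev p z + V z)ᶜ,
      ContDiffAt ℝ 2 V z ∧ lapl (n + 1) V z = 0 := by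
    intro z hz
    refine hharm z ?_
    by_contra! h
    refine hz ⟨h.1, ?_⟩
    have h1 := hpg (thinProj n z)
    have h2 := thinEmbed_thinProj z
    rw [h.1] at h2
    rw [h2] at h1
    simp only [h1, h.2]
    ring
  refine ⟨fun z => pev p z + V z, ⟨hpc.add hVc, ?_, ?_, ⟨?_, ?_⟩, ?_⟩, ?_, ?_, ?_⟩
  · intro x' t
    simp only
    rw [hpe, heven]
  · intro x'
    simp only
    rw [hpg]
    linarith [hge x']
  · exact fun z hz => ((contDiff_pev p).contDiffAt.add (hoff z hz).1).contDiffWithinAt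
  · intro z hz
    rw [lapl_add (contDiff_pev p).contDiffAt (hoff z hz).1, hlapl, (hoff z hz).2, add_zero]
  · refine superMeanVal_of_kerAvg_le (hpc.add hVc) fun c s x hc hs => ?_
    rw [kerAvg_add hc hpc hVc, kerAvg_eq_of_lapl_eq_zero (contDiff_pev p) hc hs.le hlapl, mul_add]
    linarith [hsup c s x hc hs.le]
  · obtain ⟨m, C, hC⟩ := hasPolyGrowth_pev p
    refine ⟨m, C + 1, fun x => (abs_add_le _ _).trans ?_⟩
    rw [abs_of_pos (hV0 x)]
    have : 0 ≤ ‖x‖ ^ m := by positivity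
    linarith [hC x, hV1 x]
  · rintro _ ⟨x', hx', rfl⟩
    refine ⟨thinEmbed_last x' 0, ?_⟩
    simp only [hpg, hcontact x' hx']
    ring
  · rintro z ⟨hz0, hz⟩
    have h2 := thinEmbed_thinProj z
    rw [hz0] at h2
    refine ⟨thinProj n z, ?_, h2⟩
    by_contra! h
    have h1 := hpg (thinProj n z)
    rw [h2] at h1
    have h3 : 1 < pev S (thinProj n z) ^ (k + 1) := one_lt_pow₀ (not_le.1 h) (by omega)
    have h4 : pev p z + V z = 0 := hz
    linarith [hV0 z]

end Solution

/-- for a nonconstant polynomial `f` on `ℝ^n` with bounded negativity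
set, the sublevel set `{f ≤ -δ}` is trapped between contact sets and `{f ≤ 0}`. -/
theorem statement14 (n : ℕ) (hn : 2 ≤ n)
    (f : MvPolynomial (Fin n) ℝ) (hfnc : f.totalDegree ≠ 0)
    (hbd : Bornology.IsBounded {x' : EuclideanSpace ℝ (Fin n) | pev f x' < 0})
    (δ : ℝ) (hδ : 0 < δ) :
    ∃ u : EuclideanSpace ℝ (Fin (n + 1)) → ℝ,
      IsGlobalSolution n (fun _ => 0) u ∧
      HasPolyGrowth (n + 1) u ∧
      thinSet n {x' | pev f x' ≤ -δ} ⊆ contactSet n (fun _ => 0) u ∧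
      contactSet n (fun _ => 0) u ⊆ thinSet n {x' | pev f x' ≤ 0} := by
  rcases {x' : EuclideanSpace ℝ (Fin n) | pev f x' ≤ -δ}.eq_empty_or_nonempty with hemp | ⟨x₁, hx₁⟩
  · exact exists_solution_of_sublevel_empty _ _ hemp
  obtain ⟨R, hR⟩ := hbd.subset_closedBall 0
  obtain ⟨M₀, hM₀⟩ := (isCompact_closedBall (0 : EuclideanSpace ℝ (Fin n)) R).exists_bound_of_continuousOn
    (contDiff_pev f).continuous.continuousOn
  set M := max M₀ δ with hM
  have hM0 : 0 < M := hδ.trans_le (le_max_right _ _)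
  have hfM : ∀ x, -M ≤ pev f x := by
    intro x
    rcases lt_or_ge (pev f x) 0 with h | h
    · have h1 := hM₀ x (hR h)
      rw [Real.norm_eq_abs] at h1
      linarith [neg_abs_le (pev f x), le_max_left M₀ δ]
    · linarith
  have hS : ∀ x, pev (1 + MvPolynomial.C (1 / (2 * M)) * f) x = 1 + pev f x / (2 * M) := by
    intro x
    simp only [pev, map_add, map_one, map_mul, MvPolynomial.eval_C]
    ring
  have hle : ∀ x, pev (1 + MvPolynomial.C (1 / (2 * M)) * f) x ≤ 1 - δ / (2 * M) ↔
      pev f x ≤ -δ := by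
    intro x
    rw [hS, sub_eq_add_neg, add_le_add_iff_left, ← neg_div, div_le_div_iff_of_pos_right (by positivity)]
  have hle1 : ∀ x, pev (1 + MvPolynomial.C (1 / (2 * M)) * f) x ≤ 1 ↔ pev f x ≤ 0 := by
    intro x
    rw [hS, add_le_iff_nonpos_right, div_le_iff₀ (by positivity), zero_mul]
  have := exists_solution_of_polynomial hn (1 + MvPolynomial.C (1 / (2 * M)) * f)
    (fun x => ?_) (R := R) (fun x hx => ?_) (q := 1 - δ / (2 * M)) ?_ ⟨x₁, (hle x₁).2 hx₁⟩
  · simpa only [hle, hle1] using this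
  · have h1 : -(1 / 2) ≤ pev f x / (2 * M) := by
      rw [le_div_iff₀ (by positivity)]
      linarith [hfM x]
    rw [hS]
    linarith
  · rw [hS, add_lt_iff_neg_left, div_lt_iff₀ (by positivity), zero_mul] at hx
    exact mem_closedBall_zero_iff.1 (hR hx)
  · have : 0 < δ / (2 * M) := by positivity
    linarith

end
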